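/- arXiv:1105.2648 — 2 statements merged into one kernel-verified Lean document; each statement's English description precedes it below -/
import Mathlib

section
/- Let n ≥ 1 and for each j = 1,…,n let X_j ⊆ ℂ and Y_j ⊆ ℂ be nonempty open connected sets such that the complement ℂ ∖ X_j contains at least two points and the complement ℂ ∖ Y_j contains at least two points (i.e., each X_j and Y_j is a hyperbolic planar domain). Let F = (F₁,…,Fₙ) : X₁ × ⋯ × Xₙ → Y₁ × ⋯ × Yₙ be a proper holomorphic map all of whose fibers are finite. Then there exist a permutation π of {1,…,n} and holomorphic maps g_i : X_{π(i)} → Y_i such that F_i(z₁,…,zₙ) = g_i(z_{π(i)}) for every i and every (z₁,…,zₙ) in the domain. -/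
open Set

lemma pm_exists_log {f : ℂ → ℂ} {c : ℂ} {r : ℝ} (hr : 0 < r)
    (hf : DifferentiableOn ℂ f (Metric.ball c r)) (h0 : ∀ z ∈ Metric.ball c r, f z ≠ 0) :
    ∃ g : ℂ → ℂ, DifferentiableOn ℂ g (Metric.ball c r) ∧
      (∀ z ∈ Metric.ball c r, Complex.exp (g z) = f z) ∧ g c = Complex.log (f c) := by
  have hd : DifferentiableOn ℂ (fun z => deriv f z / f z) (Metric.ball c r) :=
    (hf.deriv Metric.isOpen_ball).div hf h0
  obtain ⟨g, hgc, hg⟩ := hd.isExactOn_ball.with_val_at c (Complex.log (f c))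
  have hcb : c ∈ Metric.ball c r := Metric.mem_ball_self hr
  have hD : ∀ z ∈ Metric.ball c r, HasDerivAt (fun z => f z * Complex.exp (-g z)) 0 z := by
    intro z hz
    have h1 : HasDerivAt f (deriv f z) z :=
      (hf.differentiableAt (Metric.isOpen_ball.mem_nhds hz)).hasDerivAt
    have h2 := h1.fun_mul ((hg z hz).fun_neg.cexp)
    have e : deriv f z * Complex.exp (-g z) + f z * (Complex.exp (-g z) * -(deriv f z / f z)) = 0 := by
      have := h0 z hz
      field_simp
      ring
    rw [e] at h2
    exact h2
  have hconst : ∀ z ∈ Metric.ball c r, f z * Complex.exp (-g z) = 1 := by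
    intro z hz
    have := (convex_ball c r).is_const_of_fderivWithin_eq_zero (𝕜 := ℂ)
      (f := fun z => f z * Complex.exp (-g z))
      (fun z hz => (hD z hz).differentiableAt.differentiableWithinAt) (by
        intro z hz
        rw [fderivWithin_of_isOpen Metric.isOpen_ball hz]
        ext; simp [(hD z hz).deriv]) hz hcb
    rw [this, hgc, Complex.exp_neg, Complex.exp_log (h0 c hcb), mul_inv_cancel₀ (h0 c hcb)]
  refine ⟨g, fun z hz => (hg z hz).differentiableAt.differentiableWithinAt, ?_, hgc⟩
  intro z hz
  have := hconst z hz
  rw [Complex.exp_neg] at this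
  field_simp at this
  exact this.symm

lemma pm_bloch {G : ℂ → ℂ} {c : ℂ} {r : ℝ} (hr : 0 < r)
    (hG : DifferentiableOn ℂ G (Metric.ball c r))
    (hno : ∀ w, ¬ Metric.ball w 5 ⊆ G '' Metric.ball c r) :
    ‖deriv G c‖ ≤ 480 / r := by
  by_contra! hlt
  rw [div_lt_iff₀ hr] at hlt
  have hsub : Metric.closedBall c (r/2) ⊆ Metric.ball c r :=
    Metric.closedBall_subset_ball (by linarith)
  have hG' : DifferentiableOn ℂ (deriv G) (Metric.ball c r) := hG.deriv Metric.isOpen_ball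
  obtain ⟨p, hp, hmax⟩ := (isCompact_closedBall c (r/2)).exists_isMaxOn
    (f := fun z => (r/2 - dist z c) * ‖deriv G z‖) ⟨c, Metric.mem_closedBall_self (by linarith)⟩
    (by
      have := (hG'.continuousOn.mono hsub).norm
      fun_prop)
  have hmax' : ∀ z ∈ Metric.closedBall c (r/2),
    (r/2 - dist z c) * ‖deriv G z‖ ≤ (r/2 - dist p c) * ‖deriv G p‖ := fun z hz => hmax hz
  have h0 := hmax' c (Metric.mem_closedBall_self (by linarith))
  rw [dist_self] at h0
  set m := ‖deriv G p‖ with hm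
  set s := r/2 - dist p c with hs
  have hsm : 240 < s * m := by linarith
  have hm0 : 0 ≤ m := norm_nonneg _
  have hs0 : 0 < s := by by_contra! h; nlinarith
  have hmpos : 0 < m := by by_contra! h; nlinarith
  have hball : Metric.ball p (s/2) ⊆ Metric.ball c (r/2) := Metric.ball_subset_ball' (by linarith)
  have hball2 : Metric.ball p (s/2) ⊆ Metric.ball c r := hball.trans (Metric.ball_subset_ball (by linarith))
  have hb2 : ∀ z ∈ Metric.ball p (s/2), ‖deriv G z‖ ≤ 2 * m := by
    intro z hz
    have h1 := hmax' z (Metric.ball_subset_closedBall (hball hz))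
    have h2 : dist z c ≤ dist z p + dist p c := dist_triangle _ _ _
    rw [Metric.mem_ball] at hz
    have h3 : s/2 * ‖deriv G z‖ ≤ (r/2 - dist z c) * ‖deriv G z‖ :=
      mul_le_mul_of_nonneg_right (by linarith) (norm_nonneg _)
    have h4 : s/2 * ‖deriv G z‖ ≤ s/2 * (2*m) := by linarith
    exact le_of_mul_le_mul_left h4 (by linarith)
  have hsch : ∀ z ∈ Metric.ball p (s/2), dist (deriv G z) (deriv G p) ≤ (3*m)/(s/2) * dist z p := by
    intro z hz
    refine Complex.dist_le_div_mul_dist_of_mapsTo_ball (hG'.mono hball2) ?_ hz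
    intro y hy
    rw [Metric.mem_closedBall, dist_eq_norm]
    calc _ ≤ ‖deriv G y‖ + ‖deriv G p‖ := norm_sub_le _ _
      _ ≤ 2*m + m := by gcongr; exact hb2 y hy
      _ = 3*m := by ring
  have hcb : Metric.closedBall p (s/12) ⊆ Metric.ball p (s/2) :=
    Metric.closedBall_subset_ball (by linarith)
  have hlow : ∀ z ∈ Metric.closedBall p (s/12), m/2 * ‖z - p‖ ≤ ‖G z - G p‖ := by
    intro z hz
    have hd : ∀ y ∈ Metric.closedBall p (s/12),
        HasDerivAt (fun y => G y - deriv G p * y) (deriv G y - deriv G p) y := by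
      intro y hy
      have h1 := (hG.differentiableAt (Metric.isOpen_ball.mem_nhds (hball2 (hcb hy)))).hasDerivAt
      simpa using h1.fun_sub ((hasDerivAt_id y).const_mul (deriv G p))
    have := (convex_closedBall p (s/12)).norm_image_sub_le_of_norm_hasDerivWithin_le
      (C := m/2) (fun y hy => (hd y hy).hasDerivWithinAt) (by
        intro y hy
        rw [← dist_eq_norm]
        refine (hsch y (hcb hy)).trans ?_
        rw [Metric.mem_closedBall] at hy
        calc _ ≤ (3*m)/(s/2) * (s/12) := by gcongr
          _ = m/2 := by field_simp; norm_num) (Metric.mem_closedBall_self (by linarith)) hz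
    have h2 : G z - G p = deriv G p * (z - p) + (G z - deriv G p * z - (G p - deriv G p * p)) := by ring
    have h3 : ‖deriv G p * (z - p)‖ = m * ‖z - p‖ := by rw [norm_mul]
    have h4 := norm_sub_norm_le (deriv G p * (z - p)) (-(G z - deriv G p * z - (G p - deriv G p * p)))
    rw [sub_neg_eq_add, ← h2, norm_neg, h3] at h4
    linarith
  have := DiffContOnCl.ball_subset_image_closedBall (f := G) (z₀ := p) (r := s/12) (ε := m/2*(s/12))
    (by
      apply DifferentiableOn.diffContOnCl
      exact (hG.mono (hcb.trans hball2)).mono Metric.closure_ball_subset_closedBall)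
    (by linarith) (by
      intro z hz
      have := hlow z (Metric.sphere_subset_closedBall hz)
      rwa [mem_sphere_iff_norm.1 hz] at this) (by
      have hne : ∃ᶠ z in nhds p, z ≠ p := by
        have : (nhdsWithin p {p}ᶜ).NeBot := inferInstance
        exact Filter.frequently_iff_neBot.2 this
      refine (hne.and_eventually (Metric.closedBall_mem_nhds p (by linarith : 0 < s/12))).mono ?_
      rintro z ⟨h1, h2⟩ h3
      have := hlow z h2
      rw [h3, sub_self, norm_zero] at this
      have h5 : 0 < ‖z - p‖ := norm_pos_iff.2 (sub_ne_zero.2 h1)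
      have : 0 < m/2 * ‖z-p‖ := by positivity
      linarith)
  refine hno (G p) ((Metric.ball_subset_ball ?_).trans (this.trans (image_mono (hcb.trans hball2))))
  linarith

lemma pm_exists_cosh (y : ℝ) : ∃ x : ℝ, |x - y| ≤ 2 ∧ ∃ N : ℤ, Real.cosh x = 2 * N - 1 := by
  have key : ∀ y : ℝ, 0 ≤ y → ∃ x : ℝ, |x - y| ≤ 2 ∧ ∃ N : ℤ, Real.cosh x = 2 * N - 1 := by
    intro y hy
    have h2 : 3 ≤ Real.cosh 2 := by
      have h := Real.cosh_two_mul 1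
      have h1 := Real.cosh_sq 1
      have h3 : 1 ≤ Real.sinh 1 := Real.self_le_sinh_iff.2 zero_le_one
      norm_num at h
      nlinarith
    have h4 : Real.cosh y + 2 ≤ Real.cosh (y + 2) := by
      rw [Real.cosh_add]
      have := Real.one_le_cosh y
      have h5 : 0 ≤ Real.sinh y := Real.sinh_nonneg_iff.2 hy
      have h6 : 0 ≤ Real.sinh 2 := Real.sinh_nonneg_iff.2 zero_le_two
      nlinarith [mul_nonneg h5 h6]
    have hN1 : Real.cosh y ≤ 2 * (⌈(Real.cosh y + 1)/2⌉ : ℝ) - 1 := by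
      have := Int.le_ceil ((Real.cosh y + 1)/2); linarith
    have hN2 : 2 * (⌈(Real.cosh y + 1)/2⌉ : ℝ) - 1 ≤ Real.cosh y + 2 := by
      have := Int.ceil_lt_add_one ((Real.cosh y + 1)/2); linarith
    obtain ⟨x, hx, hx2⟩ := intermediate_value_Icc (by linarith : y ≤ y + 2)
      Real.continuous_cosh.continuousOn ⟨hN1, hN2.trans h4⟩
    exact ⟨x, by rw [abs_le]; constructor <;> linarith [hx.1, hx.2], _, hx2⟩
  rcases le_total 0 y with h | h
  · exact key y h
  · obtain ⟨x, h1, N, h2⟩ := key (-y) (by linarith)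
    refine ⟨-x, ?_, N, by rwa [Real.cosh_neg]⟩
    rw [abs_le] at *
    constructor <;> linarith [h1.1, h1.2]

lemma pm_net (w : ℂ) : ∃ q ∈ Metric.ball w 5, ∃ N : ℤ, (1 + Complex.cosh q) / 2 = N := by
  obtain ⟨x, hx, N, hN⟩ := pm_exists_cosh w.re
  set m := round (w.im / Real.pi)
  have hm : |w.im - m * Real.pi| ≤ 2 := by
    have h1 := abs_sub_round (w.im / Real.pi)
    have h2 : w.im - m * Real.pi = (w.im / Real.pi - m) * Real.pi := by
      field_simp [Real.pi_ne_zero]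
    rw [h2, abs_mul, abs_of_pos Real.pi_pos]
    have := Real.pi_le_four
    have := Real.pi_pos
    nlinarith
  have hN' : Complex.cosh (x:ℂ) = 2 * N - 1 := by
    have := congrArg (fun t : ℝ => (t : ℂ)) hN
    simpa using this
  refine ⟨x + m * Real.pi * Complex.I, ?_, ?_⟩
  · rw [Metric.mem_ball, dist_eq_norm]
    refine (Complex.norm_le_abs_re_add_abs_im _).trans_lt ?_
    have h1 : ((x:ℂ) + m * Real.pi * Complex.I - w).re = x - w.re := by simp
    have h2 : ((x:ℂ) + m * Real.pi * Complex.I - w).im = -(w.im - m * Real.pi) := by simp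
    rw [h1, h2, abs_neg]
    linarith
  · have h1 : Complex.cosh (x + m * Real.pi * Complex.I) = Complex.cosh x * Complex.cos (m * Real.pi) := by
      rw [Complex.cosh_add, Complex.cosh_mul_I, Complex.sinh_mul_I, Complex.sin_int_mul_pi]
      ring
    have h2 : Complex.cos (m * Real.pi) = 1 ∨ Complex.cos (m * Real.pi) = -1 := by
      have h3 := Complex.sin_sq_add_cos_sq (m * Real.pi)
      rw [Complex.sin_int_mul_pi] at h3
      have : (Complex.cos (m * Real.pi) - 1) * (Complex.cos (m * Real.pi) + 1) = 0 := by
        linear_combination h3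
      rcases mul_eq_zero.1 this with h | h
      · left; linear_combination h
      · right; linear_combination h
    rw [h1, hN']
    rcases h2 with h | h
    · exact ⟨N, by rw [h]; ring⟩
    · exact ⟨1 - N, by rw [h]; push_cast; ring⟩

lemma pm_landau {f : ℂ → ℂ} {c : ℂ} {r : ℝ} (hr : 0 < r)
    (hf : DifferentiableOn ℂ f (Metric.ball c r)) (h0 : ∀ z ∈ Metric.ball c r, f z ≠ 0)
    (h1 : ∀ z ∈ Metric.ball c r, f z ≠ 1) :
    ‖deriv f c‖ ≤ ‖f c‖ * (|Real.log ‖f c‖| + 3 * Real.pi) * (480 / r) := by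
  have hcb : c ∈ Metric.ball c r := Metric.mem_ball_self hr
  obtain ⟨L, hL, hLe, hLc⟩ := pm_exists_log hr hf h0
  have hpi : (Real.pi : ℂ) ≠ 0 := by exact_mod_cast Real.pi_ne_zero
  have hh : ∀ z ∈ Metric.ball c r, ∀ N : ℤ, L z / (2 * Real.pi * Complex.I) ≠ N := by
    intro z hz N hN
    apply h1 z hz
    rw [← hLe z hz, Complex.exp_eq_one_iff]
    refine ⟨N, ?_⟩
    rw [← hN]; field_simp [Complex.I_ne_zero]
  set h : ℂ → ℂ := fun z => L z / (2 * Real.pi * Complex.I) with hhdef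
  have hhd : DifferentiableOn ℂ h (Metric.ball c r) := hL.div_const _
  obtain ⟨A, hA, hAe, -⟩ := pm_exists_log hr hhd (fun z hz => by have := hh z hz 0; rwa [Int.cast_zero] at this)
  obtain ⟨B, hB, hBe, -⟩ := pm_exists_log hr (hhd.sub_const 1)
    (fun z hz => sub_ne_zero.2 (by simpa using hh z hz 1))
  have hsq : ∀ w : ℂ, Complex.exp (w/2) ^ 2 = Complex.exp w := by
    intro w; rw [← Complex.exp_nat_mul]; congr 1; push_cast; ring
  have hAA : ∀ z ∈ Metric.ball c r, Complex.exp (A z / 2) ^ 2 = h z := fun z hz => by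
    rw [hsq, hAe z hz]
  have hBB : ∀ z ∈ Metric.ball c r, Complex.exp (B z / 2) ^ 2 = h z - 1 := fun z hz => by
    rw [hsq, hBe z hz]
  have hprod : ∀ z ∈ Metric.ball c r, (Complex.exp (A z / 2) - Complex.exp (B z / 2)) *
      (Complex.exp (A z / 2) + Complex.exp (B z / 2)) = 1 := fun z hz => by
    linear_combination hAA z hz - hBB z hz
  obtain ⟨g, hg, hge, -⟩ := pm_exists_log (f := fun z => Complex.exp (A z / 2) - Complex.exp (B z / 2))
    hr ((hA.div_const 2).cexp.sub (hB.div_const 2).cexp)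
    (fun z hz => left_ne_zero_of_mul_eq_one (hprod z hz))
  set G : ℂ → ℂ := fun z => 2 * g z with hGdef
  have hGd : DifferentiableOn ℂ G (Metric.ball c r) := hg.const_mul 2
  have hcosh : ∀ z ∈ Metric.ball c r, Complex.cosh (G z) = 2 * h z - 1 := by
    intro z hz
    have e1 : Complex.exp (2 * g z) = (Complex.exp (A z / 2) - Complex.exp (B z / 2)) ^ 2 := by
      rw [← hge z hz, ← Complex.exp_nat_mul]; norm_num
    have e2 : Complex.exp (-(2 * g z)) = (Complex.exp (A z / 2) + Complex.exp (B z / 2)) ^ 2 := by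
      rw [Complex.exp_neg, e1]
      apply inv_eq_of_mul_eq_one_right
      rw [← mul_pow, hprod z hz, one_pow]
    simp only [Complex.cosh, hGdef]
    rw [e1, e2]
    linear_combination hAA z hz + hBB z hz
  have hbl := pm_bloch hr hGd (by
    intro w hw
    obtain ⟨q, hq, N, hN⟩ := pm_net w
    obtain ⟨z, hz, rfl⟩ := hw hq
    rw [hcosh z hz] at hN
    exact hh z hz N (by rw [← hN]; ring))
  have hLG : ∀ z ∈ Metric.ball c r, L z = Real.pi * Complex.I * (1 + Complex.cosh (G z)) := by
    intro z hz
    rw [hcosh z hz, hhdef]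
    field_simp [Complex.I_ne_zero]
    ring
  have hnb := Metric.isOpen_ball.mem_nhds hcb
  have hfG : f =ᶠ[nhds c] fun z => Complex.exp (Real.pi * Complex.I * (1 + Complex.cosh (G z))) := by
    filter_upwards [hnb] with z hz
    rw [← hLG z hz, hLe z hz]
  have hGc := (hGd.differentiableAt hnb).hasDerivAt
  have hder : deriv f c = f c * (Real.pi * Complex.I * (Complex.sinh (G c) * deriv G c)) := by
    rw [hfG.deriv_eq, hfG.eq_of_nhds]
    exact (((hGc.ccosh).const_add 1).const_mul _).cexp.deriv
  have hsinh : ‖Complex.sinh (G c)‖ ≤ ‖Complex.cosh (G c)‖ + 1 := by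
    have e : Complex.sinh (G c) ^ 2 = Complex.cosh (G c) ^ 2 - 1 := by
      rw [Complex.cosh_sq]; ring
    have e2 : ‖Complex.sinh (G c)‖ ^ 2 ≤ ‖Complex.cosh (G c)‖ ^ 2 + 1 := by
      rw [← norm_pow, e, ← norm_pow]
      refine (norm_sub_le _ _).trans (by simp)
    nlinarith [norm_nonneg (Complex.cosh (G c)), norm_nonneg (Complex.sinh (G c))]
  have hLn : ‖L c‖ ≤ |Real.log ‖f c‖| + Real.pi := by
    rw [hLc]
    refine (Complex.norm_le_abs_re_add_abs_im _).trans ?_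
    rw [Complex.log_re, Complex.log_im]
    gcongr
    exact Complex.abs_arg_le_pi _
  have hch : Real.pi * ‖Complex.cosh (G c)‖ ≤ ‖L c‖ + Real.pi := by
    have e : (Real.pi : ℂ) * Complex.I * Complex.cosh (G c) = L c - Real.pi * Complex.I := by
      rw [hLG c hcb]; ring
    have e2 : ‖(Real.pi : ℂ) * Complex.I * Complex.cosh (G c)‖ = Real.pi * ‖Complex.cosh (G c)‖ := by
      simp [abs_of_pos Real.pi_pos]
    rw [← e2, e]
    refine (norm_sub_le _ _).trans (by simp [abs_of_pos Real.pi_pos])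
  have hfin : Real.pi * ‖Complex.sinh (G c)‖ ≤ |Real.log ‖f c‖| + 3 * Real.pi := by
    have := mul_le_mul_of_nonneg_left hsinh Real.pi_pos.le
    linarith
  have : ‖deriv f c‖ = ‖f c‖ * (Real.pi * ‖Complex.sinh (G c)‖) * ‖deriv G c‖ := by
    rw [hder]; simp [abs_of_pos Real.pi_pos]; ring
  rw [this]
  have := Real.pi_pos
  gcongr

lemma pm_landau_pow : ∃ C : ℝ, 0 < C ∧ ∀ {f : ℂ → ℂ} {c : ℂ} {r : ℝ}, 0 < r →
    DifferentiableOn ℂ f (Metric.ball c r) → (∀ z ∈ Metric.ball c r, f z ≠ 0) →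
    (∀ z ∈ Metric.ball c r, f z ≠ 1) →
    ‖deriv f c‖ ^ 4 ≤ C / r ^ 4 * (‖f c‖ ^ 3 + ‖f c‖ ^ 5) := by
  refine ⟨480 ^ 4 * (24 * Real.exp 12), by positivity, ?_⟩
  intro f c r hr hf h0 h1
  have hx : 0 < ‖f c‖ := norm_pos_iff.2 (h0 c (Metric.mem_ball_self hr))
  have hl := pm_landau hr hf h0 h1
  set x := ‖f c‖
  have hpi := Real.pi_le_four
  have e1 : (|Real.log x| + 3 * Real.pi) ^ 4 ≤ 24 * Real.exp 12 * (x + 1 / x) := by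
    have hu : 0 ≤ |Real.log x| + 12 := by positivity
    have h2 := Real.pow_div_factorial_le_exp (|Real.log x| + 12) hu 4
    have h3 : Real.exp (|Real.log x|) ≤ x + 1 / x := by
      rcases abs_cases (Real.log x) with ⟨h, -⟩ | ⟨h, -⟩
      · rw [h, Real.exp_log hx]; have : 0 < 1 / x := by positivity
        linarith
      · rw [h, Real.exp_neg, Real.exp_log hx, one_div]; linarith
    rw [Real.exp_add] at h2
    have h4 : (|Real.log x| + 12) ^ 4 ≤ 24 * (Real.exp |Real.log x| * Real.exp 12) := by
      have : ((4).factorial : ℝ) = 24 := by norm_num [Nat.factorial]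
      rw [this] at h2
      linarith
    calc _ ≤ (|Real.log x| + 12) ^ 4 := by
            have := Real.pi_pos
            gcongr; linarith
      _ ≤ _ := h4
      _ ≤ 24 * ((x + 1/x) * Real.exp 12) := by gcongr
      _ = _ := by ring
  calc ‖deriv f c‖ ^ 4 ≤ (x * (|Real.log x| + 3 * Real.pi) * (480 / r)) ^ 4 := by gcongr
    _ = x ^ 4 * (|Real.log x| + 3 * Real.pi) ^ 4 * (480 / r) ^ 4 := by ring
    _ ≤ x ^ 4 * (24 * Real.exp 12 * (x + 1 / x)) * (480 / r) ^ 4 := by gcongr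
    _ = _ := by field_simp; ring

/-- version for two arbitrary omitted values -/
lemma pm_landau_two : ∃ C : ℝ, 0 < C ∧ ∀ {f : ℂ → ℂ} {c a b : ℂ} {r : ℝ}, 0 < r → a ≠ b →
    DifferentiableOn ℂ f (Metric.ball c r) → (∀ z ∈ Metric.ball c r, f z ≠ a) →
    (∀ z ∈ Metric.ball c r, f z ≠ b) →
    ‖deriv f c‖ ^ 4 ≤ C / r ^ 4 * (‖b - a‖ * ‖f c - a‖ ^ 3 + ‖f c - a‖ ^ 5 / ‖b - a‖) := by
  obtain ⟨C, hC, H⟩ := pm_landau_pow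
  refine ⟨C, hC, ?_⟩
  intro f c a b r hr hab hf ha hb
  have hba : b - a ≠ 0 := sub_ne_zero.2 hab.symm
  have hd : 0 < ‖b - a‖ := norm_pos_iff.2 hba
  have := H (f := fun z => (f z - a) / (b - a)) hr ((hf.sub_const a).div_const _)
    (fun z hz => div_ne_zero (sub_ne_zero.2 (ha z hz)) hba)
    (fun z hz h => hb z hz (by rw [div_eq_one_iff_eq hba] at h; simpa using h))
  rw [deriv_div_const, deriv_sub_const, norm_div, norm_div, div_pow, div_pow, div_pow,
    div_le_iff₀ (by positivity)] at this
  refine this.trans (le_of_eq ?_)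
  field_simp

lemma pm_real {C d x y D : ℝ} (hC : 0 < C) (hd : 0 < d) (hx : 0 < x) (hy : 0 < y)
    (h1 : D ^ 4 ≤ C * (d * x ^ 3 + x ^ 5 / d)) (h2 : D ^ 4 ≤ C * (d * y ^ 3 + y ^ 5 / d))
    (t1 : x ≤ y + d) (t3 : d ≤ x + y) :
    (x ≤ d / 2 ∧ (D ^ 3 / (x ^ 2 * y ^ 2)) ^ 4 ≤ (2 * C * d) ^ 3 / (d / 2) ^ 8 * x) ∨
    (y ≤ d / 2 ∧ (D ^ 3 / (x ^ 2 * y ^ 2)) ^ 4 ≤ (2 * C * d) ^ 3 / (d / 2) ^ 8 * y) ∨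
    (d / 2 ≤ x ∧ d / 2 ≤ y ∧ (D ^ 3 / (x ^ 2 * y ^ 2)) ^ 4 ≤ (5 * C / d) ^ 3 * 3 ^ 8 / x) := by
  have key : ∀ x y : ℝ, 0 < x → 0 < y → D ^ 4 ≤ C * (d * x ^ 3 + x ^ 5 / d) → d ≤ x + y →
      x ≤ d / 2 → (D ^ 3 / (x ^ 2 * y ^ 2)) ^ 4 ≤ (2 * C * d) ^ 3 / (d / 2) ^ 8 * x := by
    intro x y hx hy h1 t3 hxd
    have e1 : D ^ 4 ≤ 2 * C * d * x ^ 3 := by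
      have : x ^ 5 / d ≤ d * x ^ 3 := by
        rw [div_le_iff₀ hd]
        have : x ^ 2 ≤ d * d := by nlinarith
        have := mul_le_mul_of_nonneg_right this (by positivity : 0 ≤ x ^ 3)
        nlinarith
      nlinarith
    have e2 : (D ^ 4) ^ 3 ≤ (2 * C * d * x ^ 3) ^ 3 := by gcongr
    have hyd : d / 2 ≤ y := by linarith
    calc (D ^ 3 / (x ^ 2 * y ^ 2)) ^ 4 = (D ^ 4) ^ 3 / (x ^ 8 * y ^ 8) := by field_simp
      _ ≤ (2 * C * d * x ^ 3) ^ 3 / (x ^ 8 * (d / 2) ^ 8) := by gcongr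
      _ = _ := by field_simp
  rcases le_total x (d / 2) with hxd | hxd
  · exact Or.inl ⟨hxd, key x y hx hy h1 t3 hxd⟩
  rcases le_total y (d / 2) with hyd | hyd
  · refine Or.inr (Or.inl ⟨hyd, ?_⟩)
    have := key y x hy hx h2 (by linarith) hyd
    rwa [mul_comm (y ^ 2)] at this
  refine Or.inr (Or.inr ⟨hxd, hyd, ?_⟩)
  have e1 : D ^ 4 ≤ 5 * C / d * x ^ 5 := by
    have : d * x ^ 3 ≤ 4 / d * x ^ 5 := by
      rw [div_mul_eq_mul_div, le_div_iff₀ hd]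
      have : d * d ≤ 4 * x ^ 2 := by nlinarith
      have := mul_le_mul_of_nonneg_right this (by positivity : 0 ≤ x ^ 3)
      nlinarith
    calc D ^ 4 ≤ _ := h1
      _ ≤ C * (4 / d * x ^ 5 + x ^ 5 / d) := by gcongr
      _ = _ := by ring
  have e2 : (D ^ 4) ^ 3 ≤ (5 * C / d * x ^ 5) ^ 3 := by gcongr
  have hyx : x / 3 ≤ y := by linarith
  calc (D ^ 3 / (x ^ 2 * y ^ 2)) ^ 4 = (D ^ 4) ^ 3 / (x ^ 8 * y ^ 8) := by field_simp
      _ ≤ (5 * C / d * x ^ 5) ^ 3 / (x ^ 8 * (x / 3) ^ 8) := by gcongr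
      _ = _ := by field_simp

lemma pm_key {Y : Set ℂ} (hY : IsOpen Y) {a b : ℂ} (ha : a ∉ Y) (hb : b ∉ Y) (hab : a ≠ b)
    {r : ℝ} (hr : 0 < r) :
    (∃ M : ℝ, 0 < M ∧ ∀ (f : ℂ → ℂ) (c : ℂ), DifferentiableOn ℂ f (Metric.ball c r) →
      MapsTo f (Metric.ball c r) Y →
      ‖deriv f c ^ 3 / ((f c - a) ^ 2 * (f c - b) ^ 2)‖ ≤ M) ∧
    ∀ ε : ℝ, 0 < ε → ∃ K : Set ℂ, IsCompact K ∧ K ⊆ Y ∧ ∀ (f : ℂ → ℂ) (c : ℂ),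
      DifferentiableOn ℂ f (Metric.ball c r) → MapsTo f (Metric.ball c r) Y →
      ε ≤ ‖deriv f c ^ 3 / ((f c - a) ^ 2 * (f c - b) ^ 2)‖ → f c ∈ K := by
  obtain ⟨C0, hC0, H⟩ := pm_landau_two
  set C := C0 / r ^ 4 with hCdef
  have hC : 0 < C := by positivity
  have H' : ∀ (f : ℂ → ℂ) (c : ℂ), DifferentiableOn ℂ f (Metric.ball c r) →
      MapsTo f (Metric.ball c r) Y → ∀ p q, p ∉ Y → q ∉ Y → p ≠ q →
      ‖deriv f c‖ ^ 4 ≤ C * (‖q - p‖ * ‖f c - p‖ ^ 3 + ‖f c - p‖ ^ 5 / ‖q - p‖) := by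
    intro f c hf hm p q hp hq hpq
    exact H hr hpq hf (fun z hz h => hp (h ▸ hm hz)) (fun z hz h => hq (h ▸ hm hz))
  set d := ‖b - a‖ with hd
  have hd0 : 0 < d := norm_pos_iff.2 (sub_ne_zero.2 hab.symm)
  set M1 := (2 * C * d) ^ 3 / (d / 2) ^ 8 with hM1
  set M2 := (5 * C / d) ^ 3 * 3 ^ 8 with hM2
  have hM1p : 0 < M1 := by positivity
  have hM2p : 0 < M2 := by positivity
  have hne : ∀ (f : ℂ → ℂ) (c : ℂ), MapsTo f (Metric.ball c r) Y → 0 < ‖f c - a‖ ∧ 0 < ‖f c - b‖ := by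
    intro f c hm
    have := hm (Metric.mem_ball_self hr)
    exact ⟨norm_pos_iff.2 (sub_ne_zero.2 fun h => ha (h ▸ this)),
      norm_pos_iff.2 (sub_ne_zero.2 fun h => hb (h ▸ this))⟩
  have tri : ∀ w : ℂ, ‖w - a‖ ≤ ‖w - b‖ + d ∧ ‖w - b‖ ≤ ‖w - a‖ + d ∧ d ≤ ‖w - a‖ + ‖w - b‖ := by
    intro w
    refine ⟨?_, ?_, ?_⟩
    · have := norm_add_le (w - b) (b - a); rwa [show w - b + (b - a) = w - a by ring] at this
    · have := norm_sub_le (w - a) (b - a); rwa [show w - a - (b - a) = w - b by ring] at this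
    · have := norm_sub_le (w - a) (w - b); rwa [show w - a - (w - b) = b - a by ring] at this
  have R : ∀ (f : ℂ → ℂ) (c : ℂ), DifferentiableOn ℂ f (Metric.ball c r) →
      MapsTo f (Metric.ball c r) Y → _ := fun f c hf hm =>
    pm_real hC hd0 (hne f c hm).1 (hne f c hm).2
      (H' f c hf hm a b ha hb hab)
      (by have := H' f c hf hm b a hb ha hab.symm; rwa [norm_sub_rev a b] at this)
      (tri (f c)).1 (tri (f c)).2.2
  have hn : ∀ (f : ℂ → ℂ) (c : ℂ), ‖deriv f c ^ 3 / ((f c - a) ^ 2 * (f c - b) ^ 2)‖ =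
      ‖deriv f c‖ ^ 3 / (‖f c - a‖ ^ 2 * ‖f c - b‖ ^ 2) := by
    intro f c; simp
  constructor
  · refine ⟨max 1 (M1 * (d / 2) + M2 / (d / 2)), by positivity, ?_⟩
    intro f c hf hm
    rw [hn]
    set Q := ‖deriv f c‖ ^ 3 / (‖f c - a‖ ^ 2 * ‖f c - b‖ ^ 2) with hQ
    have hQ4 : Q ^ 4 ≤ M1 * (d / 2) + M2 / (d / 2) := by
      have p1 : 0 < M1 * (d / 2) := by positivity
      have p2 : 0 < M2 / (d / 2) := by positivity
      rcases R f c hf hm with ⟨h1, h2⟩ | ⟨h1, h2⟩ | ⟨h1, -, h2⟩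
      · have := mul_le_mul_of_nonneg_left h1 hM1p.le
        linarith
      · have := mul_le_mul_of_nonneg_left h1 hM1p.le
        linarith
      · have : M2 / ‖f c - a‖ ≤ M2 / (d / 2) := by gcongr
        exact (h2.trans this).trans (by linarith)
    rcases le_total Q 1 with h | h
    · exact h.trans (le_max_left _ _)
    · exact ((le_self_pow₀ h (by norm_num)).trans hQ4).trans (le_max_right _ _)
  · intro ε hε
    set δ := min (d / 2) (ε ^ 4 / M1) with hδ
    have hδ0 : 0 < δ := by positivity
    set Rr := 2 * d + M2 / ε ^ 4 with hRr
    have hRd : 0 < M2 / ε ^ 4 := by positivity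
    set L := Rr + d + 1 with hL
    set C2 := C * (L + 2 / d) with hC2
    have hL0 : 0 < L := by positivity
    have hC20 : 0 < C2 := by positivity
    set η := ε * (δ ^ 2 * δ ^ 2) with hη
    set ρ := min 1 (η ^ 4 / C2 ^ 3) with hρ
    have hρ0 : 0 < ρ := by positivity
    refine ⟨Metric.closedBall a Rr ∩ {w | ρ ≤ Metric.infDist w Yᶜ}, ?_, ?_, ?_⟩
    · refine (isCompact_closedBall a Rr).inter_right ?_
      exact isClosed_le continuous_const (Metric.continuous_infDist_pt _)
    · rintro w ⟨-, hw⟩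
      by_contra h
      have : Metric.infDist w Yᶜ = 0 := Metric.infDist_zero_of_mem h
      rw [mem_ofPred_eq, this] at hw
      linarith
    · intro f c hf hm hεQ
      rw [hn] at hεQ
      obtain ⟨hx, hy⟩ := hne f c hm
      obtain ⟨t1, t2, t3⟩ := tri (f c)
      have hR := R f c hf hm
      set Q := ‖deriv f c‖ ^ 3 / (‖f c - a‖ ^ 2 * ‖f c - b‖ ^ 2) with hQ
      have hε4 : ε ^ 4 ≤ Q ^ 4 := by gcongr
      have hxyR : δ ≤ ‖f c - a‖ ∧ δ ≤ ‖f c - b‖ ∧ ‖f c - a‖ ≤ Rr := by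
        have m1 : δ ≤ d / 2 := min_le_left _ _
        have m2 : δ ≤ ε ^ 4 / M1 := min_le_right _ _
        rcases hR with ⟨h1, h2⟩ | ⟨h1, h2⟩ | ⟨h1, h1', h2⟩
        · have : ε ^ 4 / M1 ≤ ‖f c - a‖ := by
            rw [div_le_iff₀ hM1p]; linarith
          exact ⟨by linarith, by linarith, by linarith⟩
        · have : ε ^ 4 / M1 ≤ ‖f c - b‖ := by
            rw [div_le_iff₀ hM1p]; linarith
          exact ⟨by linarith, by linarith, by linarith⟩
        · have : ‖f c - a‖ ≤ M2 / ε ^ 4 := by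
            rw [le_div_iff₀ (by positivity)]
            have := hε4.trans h2
            rw [le_div_iff₀ hx] at this
            linarith
          exact ⟨by linarith, by linarith, by linarith⟩
      obtain ⟨hxδ, hyδ, hxR⟩ := hxyR
      refine ⟨by rwa [Metric.mem_closedBall, dist_eq_norm], ?_⟩
      rw [mem_ofPred_eq]
      by_contra! hlt
      obtain ⟨p, hp, hpd⟩ := hY.isClosed_compl.exists_infDist_eq_dist ⟨a, ha⟩ (f c)
      rw [hpd, dist_eq_norm] at hlt
      set s := ‖f c - p‖ with hs
      have hs0 : 0 ≤ s := norm_nonneg _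
      have hs1 : s < 1 := hlt.trans_le (min_le_left _ _)
      have hηD : η ≤ ‖deriv f c‖ ^ 3 := by
        rw [le_div_iff₀ (by positivity)] at hεQ
        refine le_trans ?_ hεQ
        rw [hη]; gcongr
      obtain ⟨e, he, hpe, he1, he2⟩ : ∃ e, e ∉ Y ∧ p ≠ e ∧ d / 2 ≤ ‖e - p‖ ∧ ‖e - p‖ ≤ L := by
        have tp := (tri p).2.2
        have q1 : ‖a - p‖ ≤ ‖f c - a‖ + s := by
          have := norm_sub_le (f c - p) (f c - a)
          rw [show f c - p - (f c - a) = a - p by ring] at this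
          linarith
        have q2 : ‖b - p‖ ≤ ‖f c - b‖ + s := by
          have := norm_sub_le (f c - p) (f c - b)
          rw [show f c - p - (f c - b) = b - p by ring] at this
          linarith
        rw [norm_sub_rev p a, norm_sub_rev p b] at tp
        rcases le_total (d / 2) ‖a - p‖ with h | h
        · refine ⟨a, ha, ?_, h, by linarith⟩
          rintro rfl
          rw [sub_self, norm_zero] at h; linarith
        · refine ⟨b, hb, ?_, by linarith, by linarith⟩
          rintro rfl
          rw [sub_self, norm_zero] at tp; linarith
      have hD4 := H' f c hf hm p e hp he hpe
      have hs35 : s ^ 5 ≤ s := pow_le_of_le_one hs0 hs1.le (by norm_num)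
      have hs3 : s ^ 3 ≤ s := pow_le_of_le_one hs0 hs1.le (by norm_num)
      have hD4' : ‖deriv f c‖ ^ 4 ≤ C2 * s := by
        calc _ ≤ _ := hD4
          _ ≤ C * (L * s + s / (d / 2)) := by gcongr
          _ = _ := by rw [hC2]; field_simp
      have f1 : η ^ 4 ≤ C2 ^ 3 * s := by
        calc η ^ 4 ≤ (‖deriv f c‖ ^ 3) ^ 4 := by gcongr
          _ = (‖deriv f c‖ ^ 4) ^ 3 := by ring
          _ ≤ (C2 * s) ^ 3 := by gcongr
          _ = C2 ^ 3 * s ^ 3 := by ring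
          _ ≤ _ := by gcongr
      have f2 : s < η ^ 4 / C2 ^ 3 := hlt.trans_le (min_le_right _ _)
      rw [lt_div_iff₀ (by positivity)] at f2
      linarith

lemma pm_zero_of_vanish {U : Set ℂ} (hU : IsOpen U) (hUc : IsConnected U) {h : ℂ → ℂ}
    (hd : DifferentiableOn ℂ h U)
    (hv : ∀ ε : ℝ, 0 < ε → ∃ K, IsCompact K ∧ K ⊆ U ∧ ∀ z ∈ U, ε ≤ ‖h z‖ → z ∈ K) :
    ∀ z ∈ U, h z = 0 := by
  intro p hp
  by_contra hne
  obtain ⟨K, hK, hKU, hKh⟩ := hv ‖h p‖ (norm_pos_iff.2 hne)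
  have hpK := hKh p hp le_rfl
  obtain ⟨m, hm, hmax⟩ := hK.exists_isMaxOn ⟨p, hpK⟩ (hd.continuousOn.mono hKU).norm
  have hmax' : ∀ z ∈ K, ‖h z‖ ≤ ‖h m‖ := fun z hz => hmax hz
  have hmaxU : IsMaxOn (norm ∘ h) U m := by
    intro z hz
    by_cases hzK : z ∈ K
    · exact hmax' z hzK
    · have : ‖h z‖ < ‖h p‖ := by
        by_contra! hh; exact hzK (hKh z hz hh)
      exact this.le.trans (hmax' p hpK)
  have heq := Complex.eqOn_of_isPreconnected_of_isMaxOn_norm hUc.isPreconnected hU hd (hKU hm) hmaxU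
  have hUK : U = K := by
    refine Subset.antisymm (fun z hz => hKh z hz ?_) hKU
    rw [heq hz]
    exact hmax' p hpK
  have hcl : IsClopen U := ⟨hUK ▸ hK.isClosed, hU⟩
  have huniv : U = univ := hcl.eq_univ hUc.nonempty
  rw [← hUK, huniv] at hK
  exact noncompact_univ ℂ hK

lemma pm_param_deriv {U V : Set ℂ} (hU : IsOpen U) (hV : IsOpen V) (G : ℂ → ℂ → ℂ)
    (hc : ContinuousOn (Function.uncurry G) (U ×ˢ V))
    (h1 : ∀ s ∈ V, DifferentiableOn ℂ (fun t => G t s) U)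
    (h2 : ∀ t ∈ U, DifferentiableOn ℂ (G t) V) {s₀ : ℂ} (hs : s₀ ∈ V) :
    DifferentiableOn ℂ (fun t => deriv (G t) s₀) U := by
  obtain ⟨ρ, hρ, hρV⟩ := Metric.nhds_basis_closedBall.mem_iff.1 (hV.mem_nhds hs)
  have hbV : Metric.ball s₀ ρ ⊆ V := Metric.ball_subset_closedBall.trans hρV
  have hlim : TendstoLocallyUniformlyOn (fun (h : ℂ) t => dslope (G t) s₀ (s₀ + h))
      (fun t => deriv (G t) s₀) (nhdsWithin 0 {0}ᶜ) U := by
    rw [tendstoLocallyUniformlyOn_iff_forall_isCompact hU]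
    intro K hKU hK
    obtain ⟨M, hM⟩ := (hK.prod (isCompact_closedBall s₀ ρ)).exists_bound_of_continuousOn
      (hc.mono (prod_mono hKU hρV))
    have hM' : ∀ t ∈ K, ∀ s ∈ Metric.ball s₀ ρ, ‖G t s‖ ≤ |M| := fun t ht s hs =>
      (hM (t, s) ⟨ht, Metric.ball_subset_closedBall hs⟩).trans (le_abs_self M)
    set B := 2 * (2 * |M| / ρ) / ρ with hB
    have hB0 : 0 ≤ B := by positivity
    have hest : ∀ t ∈ K, ∀ h : ℂ, ‖h‖ < ρ →
        dist (dslope (G t) s₀ (s₀ + h)) (deriv (G t) s₀) ≤ B * ‖h‖ := by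
      intro t ht h hh
      have hd : DifferentiableOn ℂ (G t) (Metric.ball s₀ ρ) := (h2 t (hKU ht)).mono hbV
      have hb1 : ∀ s ∈ Metric.ball s₀ ρ, ‖dslope (G t) s₀ s‖ ≤ 2 * |M| / ρ := by
        intro s hs
        refine Complex.norm_dslope_le_div_of_mapsTo_ball hd ?_ hs
        intro y hy
        rw [Metric.mem_closedBall, dist_eq_norm]
        refine (norm_sub_le _ _).trans ?_
        have := hM' t ht y hy
        have := hM' t ht s₀ (Metric.mem_ball_self hρ)
        linarith
      have hdd : DifferentiableOn ℂ (dslope (G t) s₀) (Metric.ball s₀ ρ) :=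
        (Complex.differentiableOn_dslope (Metric.ball_mem_nhds _ hρ)).2 hd
      have := Complex.dist_le_div_mul_dist_of_mapsTo_ball (R₂ := 2 * (2 * |M| / ρ)) (z := s₀ + h) hdd (by
        intro y hy
        rw [Metric.mem_closedBall, dist_eq_norm]
        refine (norm_sub_le _ _).trans ?_
        have := hb1 y hy
        have := hb1 s₀ (Metric.mem_ball_self hρ)
        linarith) (by simpa using hh)
      rw [dslope_same] at this
      simpa [hB] using this
    rw [Metric.tendstoUniformlyOn_iff]
    intro ε hε
    have : Filter.Tendsto (fun h : ℂ => B * ‖h‖) (nhdsWithin 0 {0}ᶜ) (nhds 0) := by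
      have : Continuous (fun h : ℂ => B * ‖h‖) := by fun_prop
      have := this.tendsto 0
      simp only [norm_zero, mul_zero] at this
      exact this.mono_left nhdsWithin_le_nhds
    have hball : ∀ᶠ h in nhdsWithin (0:ℂ) {0}ᶜ, h ∈ Metric.ball (0:ℂ) ρ :=
      nhdsWithin_le_nhds (Metric.ball_mem_nhds _ hρ)
    filter_upwards [this.eventually_lt_const hε, hball] with h hh1 hh2 t ht
    rw [dist_comm]
    exact (hest t ht h (by simpa using hh2)).trans_lt hh1
  refine hlim.differentiableOn ?_ hU
  have hball : ∀ᶠ h in nhdsWithin (0:ℂ) {0}ᶜ, h ∈ Metric.ball (0:ℂ) ρ :=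
      nhdsWithin_le_nhds (Metric.ball_mem_nhds _ hρ)
  filter_upwards [hball, self_mem_nhdsWithin] with h hh hh0
  have hne : s₀ + h ≠ s₀ := by simpa using hh0
  have hmem : s₀ + h ∈ V := hbV (by simpa using hh)
  have : (fun t => dslope (G t) s₀ (s₀ + h)) = fun t => (s₀ + h - s₀)⁻¹ * (G t (s₀ + h) - G t s₀) := by
    funext t
    rw [dslope_of_ne _ hne, slope_def_module, smul_eq_mul]
  rw [this]
  exact ((h1 _ hmem).sub (h1 _ hs)).const_mul _

/-- separately holomorphic functions on a product of planar sets -/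
def PMSep {n : ℕ} (X : Fin n → Set ℂ) (φ : (Fin n → ℂ) → ℂ) : Prop :=
  ∀ z ∈ univ.pi X, ∀ l, DifferentiableOn ℂ (fun t => φ (Function.update z l t)) (X l)

lemma pm_upd {n : ℕ} {X : Fin n → Set ℂ} {z : Fin n → ℂ} (hz : z ∈ univ.pi X) {l : Fin n} {t : ℂ}
    (ht : t ∈ X l) : Function.update z l t ∈ univ.pi X := by
  intro k _
  by_cases h : k = l
  · subst h; simpa using ht
  · simpa [h] using hz k trivial

lemma pm_mul_zero {n : ℕ} {X : Fin n → Set ℂ} (hXo : ∀ j, IsOpen (X j))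
    (hXc : ∀ j, IsConnected (X j)) {φ ψ : (Fin n → ℂ) → ℂ} (hφ : PMSep X φ) (hψ : PMSep X ψ)
    (h0 : ∀ z ∈ univ.pi X, φ z * ψ z = 0) :
    (∀ z ∈ univ.pi X, φ z = 0) ∨ (∀ z ∈ univ.pi X, ψ z = 0) := by
  by_contra! hcon
  obtain ⟨⟨p, hp, hpφ⟩, ⟨q, hq, hqψ⟩⟩ := hcon
  have key : ∀ S : Finset (Fin n), ∃ p ∈ univ.pi X, ∃ q ∈ univ.pi X, φ p ≠ 0 ∧ ψ q ≠ 0 ∧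
      ∀ k ∈ S, p k = q k := by
    intro S
    induction S using Finset.induction_on with
    | empty => exact ⟨p, hp, q, hq, hpφ, hqψ, by simp⟩
    | insert l S hl ih =>
      obtain ⟨p, hp, q, hq, h1, h2, h3⟩ := ih
      obtain ⟨t, ht, ht1, ht2⟩ : ∃ t ∈ X l, φ (Function.update p l t) ≠ 0 ∧
          ψ (Function.update q l t) ≠ 0 := by
        by_contra! hc
        rcases AnalyticOnNhd.eq_zero_or_eq_zero_of_mul_eq_zero ((hφ p hp l).analyticOnNhd (hXo l))
          ((hψ q hq l).analyticOnNhd (hXo l)) (fun t ht => by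
            by_cases h : φ (Function.update p l t) = 0
            · rw [h, zero_mul]
            · rw [hc t ht h, mul_zero]) (hXc l).isPreconnected with h | h
        · apply h1; simpa using h (p l) (hp l trivial)
        · apply h2; simpa using h (q l) (hq l trivial)
      refine ⟨_, pm_upd hp ht, _, pm_upd hq ht, ht1, ht2, ?_⟩
      intro k hk
      by_cases hkl : k = l
      · subst hkl; simp
      · simp only [Function.update_of_ne hkl]
        exact h3 k (Finset.mem_of_mem_insert_of_ne hk hkl)
  obtain ⟨p, hp, q, hq, h1, h2, h3⟩ := key Finset.univ
  have : p = q := funext fun k => h3 k (Finset.mem_univ k)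
  subst this
  exact mul_ne_zero h1 h2 (h0 p hp)

lemma pm_prod_sep {n : ℕ} {X : Fin n → Set ℂ} {φ : Fin n → (Fin n → ℂ) → ℂ} (J : Finset (Fin n))
    (hφ : ∀ j ∈ J, PMSep X (φ j)) : PMSep X (fun z => ∏ j ∈ J, φ j z) := by
  intro z hz l
  exact DifferentiableOn.fun_finsetProd fun j hj => hφ j hj z hz l

lemma pm_prod_zero {n : ℕ} {X : Fin n → Set ℂ} (hXo : ∀ j, IsOpen (X j))
    (hXc : ∀ j, IsConnected (X j)) {φ : Fin n → (Fin n → ℂ) → ℂ} (J : Finset (Fin n)) :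
    (∀ j ∈ J, PMSep X (φ j)) → (∀ z ∈ univ.pi X, ∏ j ∈ J, φ j z = 0) →
    ∃ j ∈ J, ∀ z ∈ univ.pi X, φ j z = 0 := by
  induction J using Finset.induction_on with
  | empty =>
    intro _ h
    choose x hx using fun j => (hXc j).nonempty
    simpa using h x (fun j _ => hx j)
  | insert l S hl ih =>
    intro hφ h
    rcases pm_mul_zero hXo hXc (hφ l (Finset.mem_insert_self l S))
      (pm_prod_sep S fun j hj => hφ j (Finset.mem_insert_of_mem hj))
      (fun z hz => by have := h z hz; rwa [Finset.prod_insert hl] at this) with h1 | h1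
    · exact ⟨l, Finset.mem_insert_self l S, h1⟩
    · obtain ⟨j, hj, hj2⟩ := ih (fun j hj => hφ j (Finset.mem_insert_of_mem hj)) h1
      exact ⟨j, Finset.mem_insert_of_mem hj, hj2⟩

lemma pm_diff_update {n : ℕ} (z : Fin n → ℂ) (l : Fin n) :
    Differentiable ℂ (fun t : ℂ => Function.update z l t) := by
  rw [differentiable_pi]
  intro k
  by_cases h : k = l
  · subst h; simp
  · simp [h]

lemma pm_sep_comp {n : ℕ} {X : Fin n → Set ℂ} {φ : (Fin n → ℂ) → ℂ}
    (hφ : DifferentiableOn ℂ φ (univ.pi X)) : PMSep X φ := by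
  intro z hz l
  exact hφ.comp (pm_diff_update z l).differentiableOn (fun t ht => pm_upd hz ht)

/-- partial derivative -/
noncomputable def pmD {n : ℕ} (φ : (Fin n → ℂ) → ℂ) (k : Fin n) (z : Fin n → ℂ) : ℂ :=
  deriv (fun t => φ (Function.update z k t)) (z k)

lemma pm_sep_D {n : ℕ} {X : Fin n → Set ℂ} (hXo : ∀ j, IsOpen (X j)) {φ : (Fin n → ℂ) → ℂ}
    (hφ : DifferentiableOn ℂ φ (univ.pi X)) (k : Fin n) : PMSep X (pmD φ k) := by
  intro z hz l
  by_cases h : l = k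
  · subst h
    have : (fun t => pmD φ l (Function.update z l t)) = deriv (fun t => φ (Function.update z l t)) := by
      funext t; simp [pmD]
    rw [this]
    exact (pm_sep_comp hφ z hz l).deriv (hXo l)
  · have : (fun t => pmD φ k (Function.update z l t)) = fun t =>
        deriv (fun s => φ (Function.update (Function.update z l t) k s)) (z k) := by
      funext t
      simp only [pmD]
      rw [Function.update_of_ne (Ne.symm h)]
    rw [this]
    refine pm_param_deriv (hXo l) (hXo k)
      (fun t s => φ (Function.update (Function.update z l t) k s)) ?_ ?_ ?_ (hz k trivial)
    · refine hφ.continuousOn.comp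
        (f := fun x : ℂ × ℂ => Function.update (Function.update z l x.1) k x.2)
        (Continuous.continuousOn ?_) ?_
      · have hc1 : Continuous (fun x : ℂ × ℂ => Function.update z l x.1) :=
          (continuous_const : Continuous fun _ : ℂ × ℂ => z).update l continuous_fst
        exact hc1.update k continuous_snd
      · rintro ⟨t, s⟩ ⟨ht, hs⟩
        exact pm_upd (pm_upd hz ht) hs
    · intro s hs
      have := pm_sep_comp hφ _ (pm_upd hz hs) l
      simpa only [Function.update_comm h] using this
    · intro t ht
      exact pm_sep_comp hφ _ (pm_upd hz ht) k

lemma pm_depends {n : ℕ} {X : Fin n → Set ℂ} (hXo : ∀ j, IsOpen (X j))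
    (hXc : ∀ j, IsConnected (X j)) {φ : (Fin n → ℂ) → ℂ}
    (hφ : DifferentiableOn ℂ φ (univ.pi X)) (T : Finset (Fin n)) :
    (∀ k ∈ T, ∀ z ∈ univ.pi X, pmD φ k z = 0) →
    ∀ z ∈ univ.pi X, ∀ w ∈ univ.pi X, (∀ k ∉ T, z k = w k) → φ z = φ w := by
  induction T using Finset.induction_on with
  | empty =>
    intro _ z _ w _ h
    rw [show z = w from funext fun k => h k (by simp)]
  | insert l S hl ih =>
    intro h0 z hz w hw hzw
    have h1 : φ (Function.update z l (w l)) = φ w := by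
      refine ih (fun k hk => h0 k (Finset.mem_insert_of_mem hk)) _ (pm_upd hz (hw l trivial)) w hw ?_
      intro k hk
      by_cases hkl : k = l
      · subst hkl; simp
      · rw [Function.update_of_ne hkl]
        exact hzw k (by simp [hkl, hk])
    rw [← h1]
    have hc := (hXo l).is_const_of_deriv_eq_zero (hXc l).isPreconnected (pm_sep_comp hφ z hz l) (by
      intro t ht
      have := h0 l (Finset.mem_insert_self l S) _ (pm_upd hz ht)
      simpa [pmD] using this) (hz l trivial) (hw l trivial)
    simpa using hc

lemma pm_split {n : ℕ} {X Y : Fin n → Set ℂ}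
    (hXo : ∀ j, IsOpen (X j)) (hXc : ∀ j, IsConnected (X j))
    (hYo : ∀ j, IsOpen (Y j)) (hYhyp : ∀ j, Set.Nontrivial (Y j)ᶜ)
    {F : (Fin n → ℂ) → (Fin n → ℂ)}
    (hF : DifferentiableOn ℂ F (univ.pi X))
    (hmaps : MapsTo F (univ.pi X) (univ.pi Y))
    (hproper : ∀ K, K ⊆ univ.pi Y → IsCompact K → IsCompact (univ.pi X ∩ F ⁻¹' K))
    (l : Fin n) :
    ∃ j, (∃ k, ∃ z ∈ univ.pi X, pmD (fun z => F z j) k z ≠ 0) ∧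
      ∀ k, k ≠ l → ∀ z ∈ univ.pi X, pmD (fun z => F z j) k z = 0 := by
  classical
  by_contra! hcon
  have hFj : ∀ j, DifferentiableOn ℂ (fun z => F z j) (univ.pi X) := fun j =>
    (differentiableOn_pi.1 hF) j
  choose x₀ hx₀ using fun j => (hXc j).nonempty
  have hx₀' : x₀ ∈ univ.pi X := fun j _ => hx₀ j
  choose a ha b hb hab using hYhyp
  set J : Finset (Fin n) :=
    Finset.univ.filter (fun j => ∃ k, ∃ z ∈ univ.pi X, pmD (fun z => F z j) k z ≠ 0) with hJ
  have hk : ∀ j, ∃ k, j ∈ J → k ≠ l ∧ ∃ z ∈ univ.pi X, pmD (fun z => F z j) k z ≠ 0 := by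
    intro j
    by_cases hj : j ∈ J
    · obtain ⟨k, h1, h2⟩ := hcon j (Finset.mem_filter.1 hj).2
      exact ⟨k, fun _ => ⟨h1, h2⟩⟩
    · exact ⟨l, fun h => absurd h hj⟩
  choose κ hκ using hk
  have hconst : ∀ j, j ∉ J → ∀ z ∈ univ.pi X, F z j = F x₀ j := by
    intro j hj z hz
    refine pm_depends hXo hXc (hFj j) Finset.univ ?_ z hz x₀ hx₀' (by simp)
    intro k _ w hw
    by_contra hne
    exact hj (Finset.mem_filter.2 ⟨Finset.mem_univ _, k, w, hw, hne⟩)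
  have hFa : ∀ j, ∀ z ∈ univ.pi X, F z j - a j ≠ 0 := fun j z hz =>
    sub_ne_zero.2 fun h => ha j (h ▸ hmaps hz j trivial)
  have hFb : ∀ j, ∀ z ∈ univ.pi X, F z j - b j ≠ 0 := fun j z hz =>
    sub_ne_zero.2 fun h => hb j (h ▸ hmaps hz j trivial)
  set G : Fin n → (Fin n → ℂ) → ℂ := fun j z =>
    pmD (fun z => F z j) (κ j) z ^ 3 / ((F z j - a j) ^ 2 * (F z j - b j) ^ 2) with hG
  have hGsep : ∀ j, PMSep X (G j) := by
    intro j z hz m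
    have e1 := pm_sep_comp (hFj j) z hz m
    refine ((pm_sep_D hXo (hFj j) (κ j) z hz m).pow 3).fun_div
      (((e1.sub_const _).pow 2).fun_mul ((e1.sub_const _).pow 2)) ?_
    intro t ht
    exact mul_ne_zero (pow_ne_zero _ (hFa j _ (pm_upd hz ht)))
      (pow_ne_zero _ (hFb j _ (pm_upd hz ht)))
  have hprod : ∀ z ∈ univ.pi X, ∏ j ∈ J, G j z = 0 := by
    intro z hz
    obtain ⟨r, hr, hrX⟩ := Metric.isOpen_iff.1 (isOpen_set_pi finite_univ fun j _ => hXo j) z hz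
    have hball : ∀ k, Metric.ball (z k) r ⊆ X k := by
      intro k t ht
      have : Function.update z k t ∈ univ.pi X := by
        apply hrX
        rw [Metric.mem_ball, dist_pi_lt_iff hr]
        intro m
        by_cases h : m = k
        · subst h; simpa using ht
        · simpa [h] using hr
      simpa using this k trivial
    have hkey := fun j => pm_key (hYo j) (ha j) (hb j) (hab j) hr
    choose M hM0 hMb using fun j => (hkey j).1
    -- the slice functions
    have hsl : ∀ t ∈ X l, ∀ j ∈ J,
        DifferentiableOn ℂ (fun s => F (Function.update (Function.update z l t) (κ j) s) j)
          (Metric.ball (z (κ j)) r) ∧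
        MapsTo (fun s => F (Function.update (Function.update z l t) (κ j) s) j)
          (Metric.ball (z (κ j)) r) (Y j) ∧
        G j (Function.update z l t) =
          deriv (fun s => F (Function.update (Function.update z l t) (κ j) s) j) (z (κ j)) ^ 3 /
          ((F (Function.update (Function.update z l t) (κ j) (z (κ j))) j - a j) ^ 2 *
          (F (Function.update (Function.update z l t) (κ j) (z (κ j))) j - b j) ^ 2) ∧
        F (Function.update (Function.update z l t) (κ j) (z (κ j))) = F (Function.update z l t) := by
      intro t ht j hj
      have hκl := (hκ j hj).1
      have hzt := pm_upd hz ht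
      have e : Function.update z l t (κ j) = z (κ j) := Function.update_of_ne hκl _ _
      have e2 : Function.update (Function.update z l t) (κ j) (z (κ j)) = Function.update z l t := by
        conv_lhs => rw [← e]
        exact Function.update_eq_self _ _
      refine ⟨(pm_sep_comp (hFj j) _ hzt (κ j)).mono (hball _), ?_, ?_, by rw [e2]⟩
      · intro s hs
        exact hmaps (pm_upd hzt (hball _ hs)) j trivial
      · rw [e2]
        simp only [hG, pmD]
        rw [e]
    have hzero := pm_zero_of_vanish (hXo l) (hXc l) (h := fun t => ∏ j ∈ J, G j (Function.update z l t))
      (pm_prod_sep J (fun j _ => hGsep j) z hz l) (by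
        intro ε hε
        set P := ∏ j ∈ J, max 1 (M j) with hP
        have hP0 : 0 < P := Finset.prod_pos fun j _ => by positivity
        choose K hK hKY hKm using fun j => (hkey j).2 (ε / P) (by positivity)
        set K' : Fin n → Set ℂ := fun j => if j ∈ J then K j else {F x₀ j} with hK'
        have hK'c : IsCompact (univ.pi K') := isCompact_univ_pi fun j => by
          by_cases h : j ∈ J
          · simp only [hK', h, if_true]; exact hK j
          · simp only [hK', h, if_false]; exact isCompact_singleton
        have hK'Y : univ.pi K' ⊆ univ.pi Y := pi_mono fun j _ => by
          by_cases h : j ∈ J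
          · simp only [hK', h, if_true]; exact hKY j
          · simp only [hK', h, if_false, singleton_subset_iff]
            exact hmaps hx₀' j trivial
        have hcomp := hproper _ hK'Y hK'c
        refine ⟨(fun w : Fin n → ℂ => w l) '' (univ.pi X ∩ F ⁻¹' univ.pi K'),
          hcomp.image (continuous_apply l), ?_, ?_⟩
        · rintro _ ⟨w, ⟨hw, -⟩, rfl⟩
          exact hw l trivial
        · intro t ht hεt
          have hzt := pm_upd hz ht
          refine ⟨Function.update z l t, ⟨hzt, ?_⟩, by simp⟩
          intro j _
          by_cases hj : j ∈ J
          · simp only [hK', hj, if_true]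
            obtain ⟨s1, s2, s3, s4⟩ := hsl t ht j hj
            have := hKm j _ (z (κ j)) s1 s2 (by
              rw [← s3, div_le_iff₀ hP0]
              refine hεt.trans ?_
              rw [norm_prod, ← Finset.mul_prod_erase J _ hj]
              refine mul_le_mul_of_nonneg_left ?_ (norm_nonneg _)
              calc ∏ i ∈ J.erase j, ‖G i (Function.update z l t)‖
                  ≤ ∏ i ∈ J.erase j, max 1 (M i) := by
                    refine Finset.prod_le_prod (fun i _ => norm_nonneg _) ?_
                    intro i hi
                    obtain ⟨q1, q2, q3, -⟩ := hsl t ht i (Finset.mem_of_mem_erase hi)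
                    rw [q3]
                    exact (hMb i _ (z (κ i)) q1 q2).trans (le_max_right _ _)
                _ ≤ max 1 (M j) * ∏ i ∈ J.erase j, max 1 (M i) :=
                    le_mul_of_one_le_left (Finset.prod_nonneg fun i _ => by positivity)
                      (le_max_left _ _)
                _ = P := Finset.mul_prod_erase J (fun i => max 1 (M i)) hj)
            rwa [s4] at this
          · simp only [hK', hj, if_false, mem_singleton_iff]
            exact hconst j hj _ hzt)
    have := hzero (z l) (hz l trivial)
    simpa using this
  obtain ⟨j, hj, hj0⟩ := pm_prod_zero hXo hXc J (fun j _ => hGsep j) hprod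
  obtain ⟨-, z, hz, hne⟩ := hκ j hj
  refine div_ne_zero (pow_ne_zero 3 hne) ?_ (hj0 z hz)
  exact mul_ne_zero (pow_ne_zero _ (hFa j z hz)) (pow_ne_zero _ (hFb j z hz))

/-- **Main theorem, planar case.** Let `X₁, …, Xₙ` and `Y₁, …, Yₙ` be nonempty open connected
subsets of `ℂ` whose complements each contain at least two points (hyperbolic planar domains).
Any proper holomorphic map `F : X₁ × ⋯ × Xₙ → Y₁ × ⋯ × Yₙ` with finite fibers splits:
each component `Fᵢ` depends only on the variable `z_{π i}` for some permutation `π`. -/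
theorem planar_main_theorem (n : ℕ) (hn : 1 ≤ n) (X Y : Fin n → Set ℂ)
    (hXo : ∀ j, IsOpen (X j)) (hXc : ∀ j, IsConnected (X j))
    (hXhyp : ∀ j, Set.Nontrivial (X j)ᶜ)
    (hYo : ∀ j, IsOpen (Y j)) (hYc : ∀ j, IsConnected (Y j))
    (hYhyp : ∀ j, Set.Nontrivial (Y j)ᶜ)
    (F : (Fin n → ℂ) → (Fin n → ℂ))
    (hF : DifferentiableOn ℂ F (univ.pi X))
    (hmaps : MapsTo F (univ.pi X) (univ.pi Y))
    (hproper : ∀ K, K ⊆ univ.pi Y → IsCompact K → IsCompact (univ.pi X ∩ F ⁻¹' K))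
    (hfin : ∀ w ∈ univ.pi Y, (univ.pi X ∩ F ⁻¹' {w}).Finite) :
    ∃ (π : Equiv.Perm (Fin n)) (g : Fin n → ℂ → ℂ),
      (∀ i, DifferentiableOn ℂ (g i) (X (π i))) ∧
      (∀ i, MapsTo (g i) (X (π i)) (Y i)) ∧
      (∀ z ∈ univ.pi X, ∀ i, F z i = g i (z (π i))) := by
  have hFj : ∀ j, DifferentiableOn ℂ (fun z => F z j) (univ.pi X) := fun j =>
    (differentiableOn_pi.1 hF) j
  choose x₀ hx₀ using fun j => (hXc j).nonempty
  have hx₀' : x₀ ∈ univ.pi X := fun j _ => hx₀ j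
  choose σ hσ1 hσ2 using fun l => pm_split hXo hXc hYo hYhyp hF hmaps hproper l
  have hinj : Function.Injective σ := by
    intro l l' h
    by_contra hne
    obtain ⟨k, z, hz, hk⟩ := hσ1 l
    by_cases hkl : k = l
    · apply hk
      rw [h]
      exact hσ2 l' k (fun h' => hne (hkl.symm.trans h')) z hz
    · exact hk (hσ2 l k hkl z hz)
  let e : Equiv.Perm (Fin n) := Equiv.ofBijective σ (Finite.injective_iff_bijective.1 hinj)
  have he : ∀ i, σ (e.symm i) = i := fun i => e.apply_symm_apply i
  refine ⟨e.symm, fun i t => F (Function.update x₀ (e.symm i) t) i, ?_, ?_, ?_⟩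
  · intro i
    exact pm_sep_comp (hFj i) x₀ hx₀' _
  · intro i t ht
    exact hmaps (pm_upd hx₀' ht) i trivial
  · intro z hz i
    refine pm_depends hXo hXc (hFj i) (Finset.univ.erase (e.symm i)) ?_ z hz _
      (pm_upd hx₀' (hz _ trivial)) ?_
    · intro k hk w hw
      have := hσ2 (e.symm i) k (Finset.ne_of_mem_erase hk) w hw
      rwa [he i] at this
    · intro k hk
      have : k = e.symm i := by simpa using hk
      subst this
      simp
end

section
/- Let ℂ∞ denote the Riemann sphere. Let n ≥ 1 and for each j = 1,…,n let X_j ⊆ ℂ∞ and Y_j ⊆ ℂ∞ be nonempty open connected sets such that the complement ℂ∞ ∖ X_j contains at least three points and the complement ℂ∞ ∖ Y_j contains at least three points (i.e., each X_j and Y_j is a hyperbolic open connected subset of ℂ∞). Let F = (F₁,…,Fₙ) : X₁ × ⋯ × Xₙ → Y₁ × ⋯ × Yₙ be a proper holomorphic map all of whose fibers are finite. Then there exist a permutation π of {1,…,n} and holomorphic maps g_i : X_{π(i)} → Y_i such that F_i(z₁,…,zₙ) = g_i(z_{π(i)}) for every i and every (z₁,…,zₙ) in the domain. -/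
open Set OnePoint
open scoped Classical

/-! We model the Riemann sphere `ℂ∞` as the one-point compactification `OnePoint ℂ` of `ℂ`,
and define holomorphy of maps into (and between open subsets of) `OnePoint ℂ` by reading
the maps in the two standard charts: the identity chart on `ℂ` and the inversion chart
at `∞`. -/

/-- Reads a point of the Riemann sphere in the identity chart: `z ↦ z` on `ℂ`
(with junk value `0` at `∞`). -/
noncomputable def spDown : OnePoint ℂ → ℂ := fun z => OnePoint.elim z 0 id

/-- The inversion `z ↦ 1/z` of the Riemann sphere, interchanging `0` and `∞`. -/
noncomputable def spInv : OnePoint ℂ → OnePoint ℂ :=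
  fun z => OnePoint.elim z ((0 : ℂ) : OnePoint ℂ)
    (fun w => if w = 0 then (∞ : OnePoint ℂ) else ((w⁻¹ : ℂ) : OnePoint ℂ))

/-- A map `h` from a complex normed space into the Riemann sphere is holomorphic at `a` if it
is continuous at `a` and, read in the standard chart around the value `h a` (the identity
chart if `h a ≠ ∞`, the inversion chart if `h a = ∞`), it is analytic at `a`. -/
def SphHoloAt {E : Type*} [NormedAddCommGroup E] [NormedSpace ℂ E]
    (h : E → OnePoint ℂ) (a : E) : Prop :=
  ContinuousAt h a ∧
    ((h a ≠ ∞ ∧ AnalyticAt ℂ (fun z => spDown (h z)) a) ∨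
      (h a = ∞ ∧ AnalyticAt ℂ (fun z => spDown (spInv (h z))) a))

/-- Holomorphy on a set, for maps from a complex normed space into the Riemann sphere. -/
def SphHoloOn {E : Type*} [NormedAddCommGroup E] [NormedSpace ℂ E]
    (h : E → OnePoint ℂ) (U : Set E) : Prop :=
  ∀ a ∈ U, SphHoloAt h a

/-- The standard local parametrization of the Riemann sphere at `p`: the identity chart if
`p ≠ ∞` and the inversion chart if `p = ∞`; it maps `sphChartPt p` to `p`. -/
noncomputable def sphChart (p : OnePoint ℂ) : ℂ → OnePoint ℂ :=
  if p = ∞ then (fun z => spInv ((z : ℂ) : OnePoint ℂ)) else (fun z => ((z : ℂ) : OnePoint ℂ))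

/-- The coordinate of `p` in the standard chart at `p`. -/
noncomputable def sphChartPt (p : OnePoint ℂ) : ℂ := if p = ∞ then 0 else spDown p

/-- Holomorphy on a set `U`, for a map of one Riemann-sphere variable: at each `p ∈ U` the
map, read in the standard parametrization at `p`, is holomorphic at the coordinate of `p`. -/
def SphHoloOnS (f : OnePoint ℂ → OnePoint ℂ) (U : Set (OnePoint ℂ)) : Prop :=
  ∀ p ∈ U, SphHoloAt (fun z : ℂ => f (sphChart p z)) (sphChartPt p)

/-- Holomorphy on a set `U`, for a map of several Riemann-sphere variables: at each `p ∈ U`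
the map, read in the product of the standard parametrizations at the coordinates of `p`, is
holomorphic at the coordinates of `p`. -/
def SphHoloOnProd {n : ℕ} (f : (Fin n → OnePoint ℂ) → OnePoint ℂ)
    (U : Set (Fin n → OnePoint ℂ)) : Prop :=
  ∀ p ∈ U, SphHoloAt (fun z : Fin n → ℂ => f (fun i => sphChart (p i) (z i)))
      (fun i => sphChartPt (p i))

lemma sm_log {f : ℂ → ℂ} {c : ℂ} {R : ℝ} (hR : 0 < R)
    (hf : DifferentiableOn ℂ f (Metric.ball c R))
    (h0 : ∀ z ∈ Metric.ball c R, f z ≠ 0) (w : ℂ) (hw : Complex.exp w = f c) :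
    ∃ g : ℂ → ℂ, g c = w ∧ (∀ z ∈ Metric.ball c R, HasDerivAt g (deriv f z / f z) z) ∧
      ∀ z ∈ Metric.ball c R, Complex.exp (g z) = f z := by
  have hd : DifferentiableOn ℂ (fun z => deriv f z / f z) (Metric.ball c R) :=
    (hf.deriv Metric.isOpen_ball).div hf h0
  obtain ⟨g, hg0, hg⟩ := hd.isExactOn_ball.with_val_at c w
  refine ⟨g, hg0, hg, ?_⟩
  have hfd : ∀ z ∈ Metric.ball c R, HasDerivAt f (deriv f z) z := fun z hz =>
    (hf.differentiableAt (Metric.isOpen_ball.mem_nhds hz)).hasDerivAt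
  have hder : ∀ z ∈ Metric.ball c R, HasDerivAt (fun z => Complex.exp (-g z) * f z) 0 z := by
    intro z hz
    have h1 := ((hg z hz).neg.cexp).mul (hfd z hz)
    have h2 := h0 z hz
    refine HasDerivAt.congr_deriv (f := fun z => Complex.exp (-g z) * f z) h1 ?_
    rw [mul_assoc, ← mul_add, neg_mul, div_mul_cancel₀ _ h2, neg_add_cancel, mul_zero]
  have hc : c ∈ Metric.ball c R := Metric.mem_ball_self hR
  intro z hz
  have := Metric.isOpen_ball.is_const_of_deriv_eq_zero (convex_ball c R).isPreconnected
    (fun z hz => (hder z hz).differentiableAt.differentiableWithinAt)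
    (fun z hz => (hder z hz).deriv) hz hc
  simp only [hg0, ← hw, ← Complex.exp_add, neg_add_cancel, Complex.exp_zero] at this
  rw [Complex.exp_neg] at this
  have h2 := Complex.exp_ne_zero (g z)
  field_simp at this
  exact this.symm

lemma sm_cover {f : ℂ → ℂ} {a : ℂ} {t : ℝ} (ht : 0 < t)
    (hf : DifferentiableOn ℂ f (Metric.ball a t)) (hne : deriv f a ≠ 0)
    (hb : ∀ z ∈ Metric.ball a t, ‖deriv f z‖ ≤ 2 * ‖deriv f a‖) :
    Metric.ball (f a) (t * ‖deriv f a‖ / 24) ⊆ f '' Metric.ball a t := by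
  set A := ‖deriv f a‖ with hA
  have hApos : 0 < A := norm_pos_iff.2 hne
  have hd' : DifferentiableOn ℂ (deriv f) (Metric.ball a t) := hf.deriv Metric.isOpen_ball
  have hs : ∀ z ∈ Metric.ball a t, ‖deriv f z - deriv f a‖ ≤ 3 * A / t * ‖z - a‖ := by
    intro z hz
    have := Complex.dist_le_div_mul_dist_of_mapsTo_ball (R₂ := 3 * A) hd' (fun w hw => by
      rw [mem_closedBall_iff_norm]
      have := norm_sub_le (deriv f w) (deriv f a)
      have := hb w hw
      linarith) hz
    simpa [dist_eq_norm] using this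
  have hsub : Metric.closedBall a (t / 6) ⊆ Metric.ball a t :=
    Metric.closedBall_subset_ball (by linarith)
  have key : ∀ z ∈ Metric.sphere a (t / 6), t * A / 12 ≤ ‖f z - f a‖ := by
    intro z hz
    have hz' : ‖z - a‖ = t / 6 := by simpa [dist_eq_norm] using hz
    have h1 : ‖(f z - deriv f a * z) - (f a - deriv f a * a)‖ ≤ A / 2 * ‖z - a‖ := by
      refine (convex_closedBall a (t/6)).norm_image_sub_le_of_norm_hasDerivWithin_le
        (f := fun z => f z - deriv f a * z) (f' := fun w => deriv f w - deriv f a * 1)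
        (fun w hw => ?_) (fun w hw => ?_) ?_ ?_
      · exact ((hf.differentiableAt (Metric.isOpen_ball.mem_nhds (hsub hw))).hasDerivAt.sub
          ((hasDerivAt_id w).const_mul _)).hasDerivWithinAt
      · rw [mul_one]
        refine (hs w (hsub hw)).trans ?_
        have : ‖w - a‖ ≤ t / 6 := by simpa [dist_eq_norm] using hw
        calc 3 * A / t * ‖w - a‖ ≤ 3 * A / t * (t / 6) := by gcongr
          _ = A / 2 := by field_simp; norm_num
      · exact Metric.mem_closedBall_self (by positivity)
      · exact Metric.sphere_subset_closedBall hz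
    have h2 : ‖deriv f a * (z - a)‖ = A * (t / 6) := by rw [norm_mul, hz']
    have h3 : deriv f a * (z - a) = (f z - f a) -
      ((f z - deriv f a * z) - (f a - deriv f a * a)) := by ring
    have h4 := norm_sub_le (f z - f a) ((f z - deriv f a * z) - (f a - deriv f a * a))
    rw [← h3, h2] at h4
    rw [hz'] at h1
    linarith
  have hdc : DiffContOnCl ℂ f (Metric.ball a (t/6)) := by
    apply DifferentiableOn.diffContOnCl
    rw [closure_ball _ (by positivity)]
    exact hf.mono hsub
  have hfr : ∃ᶠ z in nhds a, f z ≠ f a := by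
    have hda : HasDerivAt f (deriv f a) a :=
      (hf.differentiableAt (Metric.isOpen_ball.mem_nhds (Metric.mem_ball_self ht))).hasDerivAt
    have h := hda.eventually_ne hne (c := f a)
    exact h.frequently.filter_mono nhdsWithin_le_nhds
  have := hdc.ball_subset_image_closedBall (by positivity) key hfr
  intro v hv
  have hv' : v ∈ Metric.ball (f a) (t * A / 12 / 2) := by
    convert hv using 2
    ring
  obtain ⟨z, hz, rfl⟩ := this hv'
  exact ⟨z, hsub hz, rfl⟩

lemma sm_bloch {f : ℂ → ℂ} {c : ℂ} {R L : ℝ} (hR : 0 < R) (hL : 0 < L)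
    (hf : DifferentiableOn ℂ f (Metric.ball c R))
    (hno : ∀ w : ℂ, ¬ (Metric.ball w L ⊆ f '' Metric.ball c R)) :
    ‖deriv f c‖ ≤ 96 * L / R := by
  by_contra hcon
  push Not at hcon
  set r := R / 2 with hr
  have hrp : 0 < r := by positivity
  have hsub : Metric.closedBall c r ⊆ Metric.ball c R :=
    Metric.closedBall_subset_ball (by linarith)
  have hd' : DifferentiableOn ℂ (deriv f) (Metric.ball c R) := hf.deriv Metric.isOpen_ball
  have hcont : ContinuousOn (fun z => (r - ‖z - c‖) * ‖deriv f z‖) (Metric.closedBall c r) :=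
    ContinuousOn.mul (by fun_prop) (hd'.continuousOn.mono hsub).norm
  obtain ⟨a, ha, hmax⟩ := (isCompact_closedBall c r).exists_isMaxOn
    ⟨c, Metric.mem_closedBall_self hrp.le⟩ hcont
  have hmax' : ∀ z, ‖z - c‖ ≤ r → (r - ‖z - c‖) * ‖deriv f z‖ ≤ (r - ‖a - c‖) * ‖deriv f a‖ :=
    fun z hz => hmax (by simpa [dist_eq_norm] using hz)
  have hM : 48 * L < (r - ‖a - c‖) * ‖deriv f a‖ := by
    have := hmax' c (by simpa using hrp.le)
    simp only [sub_self, norm_zero, sub_zero] at this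
    rw [div_lt_iff₀ hR] at hcon
    have : r * ‖deriv f c‖ = ‖deriv f c‖ * R / 2 := by rw [hr]; ring
    linarith
  have ha' : ‖a - c‖ ≤ r := by simpa [dist_eq_norm] using ha
  have hlt : 0 < r - ‖a - c‖ := by
    rcases (sub_nonneg.2 ha').lt_or_eq with h | h
    · exact h
    · rw [← h] at hM; simp at hM; linarith
  have hda : deriv f a ≠ 0 := by
    intro h; rw [h] at hM; simp at hM; linarith
  set t := (r - ‖a - c‖) / 2 with ht
  have htp : 0 < t := by positivity
  have hin : ∀ z ∈ Metric.ball a t, ‖z - c‖ ≤ r - t := by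
    intro z hz
    have h1 : ‖z - a‖ < t := by simpa [dist_eq_norm] using hz
    have h2 := norm_add_le (z - a) (a - c)
    rw [sub_add_sub_cancel] at h2
    linarith
  have hballsub : Metric.ball a t ⊆ Metric.ball c R := fun z hz => by
    have := hin z hz
    rw [mem_ball_iff_norm]; linarith
  have hc := sm_cover htp (hf.mono hballsub) hda (fun z hz => by
    have h1 := hin z hz
    have h2 := hmax' z (by linarith)
    have h3 : t * ‖deriv f z‖ ≤ (r - ‖z - c‖) * ‖deriv f z‖ := by gcongr; linarith
    have h4 : t * ‖deriv f z‖ ≤ t * (2 * ‖deriv f a‖) := by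
      calc _ ≤ _ := h3.trans h2
        _ = t * (2 * ‖deriv f a‖) := by rw [ht]; ring
    exact le_of_mul_le_mul_left h4 htp)
  apply hno (f a)
  refine (Metric.ball_subset_ball ?_).trans (hc.trans (image_mono hballsub))
  have : t * ‖deriv f a‖ = (r - ‖a - c‖) * ‖deriv f a‖ / 2 := by rw [ht]; ring
  linarith

lemma sm_cosh_step (x : ℝ) (hx : 0 ≤ x) : ∃ t : ℝ, x ≤ t ∧ t ≤ x + 2 ∧
    ∃ m : ℤ, Real.cosh t = 2 * m + 1 := by
  have h1 : Real.cosh x + 2 ≤ Real.cosh (x + 2) := by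
    rw [Real.cosh_add]
    have a1 : 1 ≤ Real.cosh x := Real.one_le_cosh x
    have a2 : 0 ≤ Real.sinh x := Real.sinh_nonneg_iff.2 hx
    have a3 : 0 ≤ Real.sinh 2 := Real.sinh_nonneg_iff.2 (by norm_num)
    have a4 : 3 ≤ Real.cosh 2 := by
      have e1 : Real.exp 2 = Real.exp 1 * Real.exp 1 := by
        rw [← Real.exp_add]; norm_num
      rw [Real.cosh_eq, e1]
      have := Real.exp_one_gt_d9
      have := Real.exp_pos (-2)
      nlinarith
    nlinarith [mul_nonneg a2 a3]
  set m : ℤ := ⌈(Real.cosh x - 1) / 2⌉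
  have h2 : (Real.cosh x - 1) / 2 ≤ m := Int.le_ceil _
  have h3 : (m : ℝ) < (Real.cosh x - 1) / 2 + 1 := Int.ceil_lt_add_one _
  obtain ⟨t, ht, htm⟩ := intermediate_value_Icc (show x ≤ x + 2 by linarith)
    Real.continuous_cosh.continuousOn (show (2 * m + 1 : ℝ) ∈ Icc _ _ from ⟨by linarith, by linarith⟩)
  exact ⟨t, ht.1, ht.2, m, htm⟩

lemma sm_net (w : ℂ) : ∃ w' ∈ Metric.ball w 8, ∃ m : ℤ, Complex.cosh w' = 2 * m - 1 := by
  obtain ⟨t, ht1, ht2, m, hm⟩ := sm_cosh_step |w.re| (abs_nonneg _)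
  obtain ⟨s, hs, hsw⟩ : ∃ s : ℝ, Real.cosh s = 2 * m + 1 ∧ |s - w.re| ≤ 2 := by
    rcases le_total 0 w.re with h | h
    · rw [abs_of_nonneg h] at *
      exact ⟨t, hm, by rw [abs_le]; constructor <;> linarith⟩
    · rw [abs_of_nonpos h] at *
      exact ⟨-t, by rw [Real.cosh_neg, hm], by rw [abs_le]; constructor <;> linarith⟩
  set k : ℤ := ⌊w.im / Real.pi⌋
  have hk1 : (k : ℝ) * Real.pi ≤ w.im := (le_div_iff₀ Real.pi_pos).1 (Int.floor_le _)
  have hk2 : w.im < (k + 1 : ℝ) * Real.pi := (div_lt_iff₀ Real.pi_pos).1 (Int.lt_floor_add_one _)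
  refine ⟨s + (k * Real.pi : ℝ) * Complex.I, ?_, ?_⟩
  · rw [mem_ball_iff_norm]
    refine (Complex.norm_le_abs_re_add_abs_im _).trans_lt ?_
    have : |k * Real.pi - w.im| ≤ 4 := by
      have := Real.pi_lt_four
      rw [abs_le]; constructor <;> nlinarith
    simp only [Complex.sub_re, Complex.add_re, Complex.ofReal_re, Complex.mul_re, Complex.I_re,
      mul_zero, Complex.ofReal_im, Complex.I_im, Complex.sub_im, Complex.add_im, Complex.mul_im]
    simp only [mul_one, sub_self, add_zero, zero_add]
    linarith
  · rw [Complex.cosh_add, Complex.cosh_mul_I, Complex.sinh_mul_I, ← Complex.ofReal_cos,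
      ← Complex.ofReal_sin, Real.sin_int_mul_pi, ← Complex.ofReal_cosh, hs, Real.cos_int_mul_pi]
    rcases Int.even_or_odd k with h | h
    · exact ⟨m + 1, by rw [h.neg_one_zpow]; push_cast; ring⟩
    · exact ⟨-m, by rw [h.neg_one_zpow]; push_cast; ring⟩
lemma sm_landau_int {F : ℂ → ℂ} {c : ℂ} {R : ℝ} (hR : 0 < R)
    (hF : DifferentiableOn ℂ F (Metric.ball c R))
    (hZ : ∀ z ∈ Metric.ball c R, ∀ m : ℤ, F z ≠ m) :
    ‖deriv F c‖ ≤ 768 / R * (‖F c‖ + 1) := by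
  have hc : c ∈ Metric.ball c R := Metric.mem_ball_self hR
  have h0 : ∀ z ∈ Metric.ball c R, F z ≠ 0 := fun z hz => by simpa using hZ z hz 0
  have h1 : ∀ z ∈ Metric.ball c R, F z - 1 ≠ 0 := fun z hz => by
    have := hZ z hz 1
    rw [sub_ne_zero]; simpa using this
  have hP : DifferentiableOn ℂ (fun z => F z * (F z - 1)) (Metric.ball c R) :=
    hF.mul (hF.sub_const 1)
  obtain ⟨l, -, hl, hle⟩ := sm_log hR hP (fun z hz => mul_ne_zero (h0 z hz) (h1 z hz))
    (Complex.log (F c * (F c - 1))) (Complex.exp_log (mul_ne_zero (h0 c hc) (h1 c hc)))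
  have hld : DifferentiableOn ℂ l (Metric.ball c R) := fun z hz =>
    (hl z hz).differentiableAt.differentiableWithinAt
  set s : ℂ → ℂ := fun z => Complex.exp (l z / 2) with hs
  have hsd : DifferentiableOn ℂ s (Metric.ball c R) := (hld.div_const 2).cexp
  have hs2 : ∀ z ∈ Metric.ball c R, s z ^ 2 = F z * (F z - 1) := by
    intro z hz
    rw [← hle z hz, hs]
    simp only
    rw [← Complex.exp_nat_mul]
    congr 1; push_cast; ring
  set E : ℂ → ℂ := fun z => 2 * F z - 1 + 2 * s z with hE
  have hEd : DifferentiableOn ℂ E (Metric.ball c R) :=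
    ((hF.const_mul 2).sub_const 1).add (hsd.const_mul 2)
  have hEm : ∀ z ∈ Metric.ball c R, E z * (2 * F z - 1 - 2 * s z) = 1 := by
    intro z hz
    have := hs2 z hz
    simp only [hE]
    linear_combination (-4) * this
  have hE0 : ∀ z ∈ Metric.ball c R, E z ≠ 0 := fun z hz h => by
    have := hEm z hz
    rw [h] at this; simp at this
  obtain ⟨v, -, hv, hve⟩ := sm_log hR hEd hE0 (Complex.log (E c)) (Complex.exp_log (hE0 c hc))
  have hvd : DifferentiableOn ℂ v (Metric.ball c R) := fun z hz =>
    (hv z hz).differentiableAt.differentiableWithinAt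
  have hvn : ∀ z ∈ Metric.ball c R, Complex.exp (-v z) = 2 * F z - 1 - 2 * s z := by
    intro z hz
    rw [Complex.exp_neg, hve z hz]
    exact inv_eq_of_mul_eq_one_right (hEm z hz)
  have hcosh : ∀ z ∈ Metric.ball c R, Complex.cosh (v z) = 2 * F z - 1 := by
    intro z hz
    rw [Complex.cosh, hvn z hz, hve z hz, hE]; ring
  have hsinh : Complex.sinh (v c) = 2 * s c := by
    rw [Complex.sinh, hvn c hc, hve c hc, hE]; ring
  have hB := sm_bloch hR (show (0:ℝ) < 8 by norm_num) hvd (fun w hw => by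
    obtain ⟨w', hw', m, hm⟩ := sm_net w
    obtain ⟨z, hz, rfl⟩ := hw hw'
    rw [hcosh z hz] at hm
    apply hZ z hz m
    linear_combination hm / 2)
  have hder : deriv F c = s c * deriv v c := by
    have hv1 : HasDerivAt v (deriv v c) c := (hv c hc).differentiableAt.hasDerivAt
    have hF1 : HasDerivAt F (deriv F c) c :=
      (hF.differentiableAt (Metric.isOpen_ball.mem_nhds hc)).hasDerivAt
    have e1 := hv1.ccosh
    have e2 := (hF1.const_mul 2).sub_const 1
    have heq : (fun z => Complex.cosh (v z)) =ᶠ[nhds c] fun z => 2 * F z - 1 :=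
      Filter.eventually_of_mem (Metric.isOpen_ball.mem_nhds hc) hcosh
    have := e1.unique (e2.congr_of_eventuallyEq heq)
    rw [hsinh] at this
    linear_combination -this / 2
  have hsn : ‖s c‖ ≤ ‖F c‖ + 1 := by
    have e := congrArg norm (hs2 c hc)
    rw [norm_pow, norm_mul] at e
    have := norm_sub_le (F c) 1
    rw [norm_one] at this
    have h3 := norm_nonneg (F c)
    refine (sq_le_sq₀ (norm_nonneg _) (by positivity)).1 ?_
    rw [e]; nlinarith
  rw [hder, norm_mul, mul_comm]
  have : (96 * 8 / R : ℝ) = 768 / R := by norm_num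
  rw [this] at hB
  gcongr

/-- Landau type estimate. -/
lemma sm_landau {f : ℂ → ℂ} {c : ℂ} {R : ℝ} (hR : 0 < R)
    (hf : DifferentiableOn ℂ f (Metric.ball c R))
    (h0 : ∀ z ∈ Metric.ball c R, f z ≠ 0) (h1 : ∀ z ∈ Metric.ball c R, f z ≠ 1) :
    ‖deriv f c‖ ≤ 8000 / R * (‖f c‖ * (|Real.log ‖f c‖| + 1)) := by
  have hc : c ∈ Metric.ball c R := Metric.mem_ball_self hR
  obtain ⟨g, hgc, hg, hge⟩ := sm_log hR hf h0 (Complex.log (f c)) (Complex.exp_log (h0 c hc))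
  have hI : (2 * Real.pi * Complex.I : ℂ) ≠ 0 := Complex.two_pi_I_ne_zero
  have hF : ∀ z ∈ Metric.ball c R, HasDerivAt (fun z => g z / (2 * Real.pi * Complex.I))
      ((deriv f z / f z) / (2 * Real.pi * Complex.I)) z := fun z hz => (hg z hz).div_const _
  have hL := sm_landau_int hR
    (fun z hz => (hF z hz).differentiableAt.differentiableWithinAt) (fun z hz m hm => by
      rw [div_eq_iff hI] at hm
      apply h1 z hz
      rw [← hge z hz, hm]
      exact Complex.exp_int_mul_two_pi_mul_I m)
  rw [(hF c hc).deriv, hgc] at hL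
  have hn : ‖(2 * Real.pi * Complex.I : ℂ)‖ = 2 * Real.pi := by
    simp [abs_of_pos Real.pi_pos]
  rw [norm_div, norm_div, norm_div, hn] at hL
  have hfc : 0 < ‖f c‖ := norm_pos_iff.2 (h0 c hc)
  have hlog : ‖Complex.log (f c)‖ ≤ |Real.log ‖f c‖| + Real.pi := by
    refine (Complex.norm_le_abs_re_add_abs_im _).trans ?_
    rw [Complex.log_re, Complex.log_im]
    gcongr
    exact Complex.abs_arg_le_pi _
  have hp := Real.pi_pos
  have hp4 := Real.pi_lt_d2
  have hp3 := Real.pi_gt_three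
  have hx := abs_nonneg (Real.log ‖f c‖)
  rw [div_div, div_le_iff₀ (by positivity)] at hL
  refine hL.trans ?_
  have : (‖Complex.log (f c)‖ / (2 * Real.pi) + 1) * (2 * Real.pi) ≤ 10 * (|Real.log ‖f c‖| + 1) := by
    rw [add_mul, div_mul_cancel₀ _ (by positivity)]; linarith
  calc 768 / R * (‖Complex.log (f c)‖ / (2 * Real.pi) + 1) * (‖f c‖ * (2 * Real.pi))
      = 768 / R * ‖f c‖ * ((‖Complex.log (f c)‖ / (2 * Real.pi) + 1) * (2 * Real.pi)) := by ring
    _ ≤ 768 / R * ‖f c‖ * (10 * (|Real.log ‖f c‖| + 1)) := by gcongr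
    _ = 7680 / R * (‖f c‖ * (|Real.log ‖f c‖| + 1)) := by ring
    _ ≤ _ := by gcongr; norm_num

/-- Landau estimate for maps omitting `p ≠ q`. -/
lemma sm_landau2 {f : ℂ → ℂ} {c p q : ℂ} {R : ℝ} (hR : 0 < R) (hpq : p ≠ q)
    (hf : DifferentiableOn ℂ f (Metric.ball c R))
    (h0 : ∀ z ∈ Metric.ball c R, f z ≠ p) (h1 : ∀ z ∈ Metric.ball c R, f z ≠ q) :
    ‖deriv f c‖ ≤ 8000 / R *
      (‖f c - p‖ * (|Real.log (‖f c - p‖ / ‖q - p‖)| + 1)) := by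
  have hd : q - p ≠ 0 := sub_ne_zero.2 hpq.symm
  have hdn : 0 < ‖q - p‖ := norm_pos_iff.2 hd
  have := sm_landau (f := fun z => (f z - p) / (q - p)) hR ((hf.sub_const p).div_const _)
    (fun z hz => div_ne_zero (sub_ne_zero.2 (h0 z hz)) hd)
    (fun z hz h => by
      rw [div_eq_one_iff_eq hd] at h
      exact h1 z hz (sub_left_injective h))
  rw [deriv_div_const, deriv_sub_const, norm_div, norm_div, div_le_iff₀ hdn] at this
  refine this.trans (le_of_eq ?_)
  field_simp
lemma sm_lim_top : Filter.Tendsto (fun x : ℝ => (|Real.log x| + 1) ^ 3 / x) Filter.atTop (nhds 0) := by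
  have h := (Real.isLittleO_pow_log_id_atTop (n := 3)).tendsto_div_nhds_zero
  have h2 := h.const_mul 8
  rw [mul_zero] at h2
  refine squeeze_zero' ?_ ?_ h2
  · filter_upwards [Filter.eventually_gt_atTop 0] with x hx
    positivity
  · filter_upwards [Filter.eventually_gt_atTop 0,
      Real.tendsto_log_atTop.eventually_ge_atTop 1] with x hx hl
    rw [abs_of_nonneg (by linarith), ← mul_div_assoc]
    simp only [id]
    gcongr
    calc (Real.log x + 1) ^ 3 ≤ (2 * Real.log x) ^ 3 := by gcongr; linarith
      _ = _ := by ring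

lemma sm_lim_zero : Filter.Tendsto (fun x : ℝ => x * (|Real.log x| + 1) ^ 3)
    (nhdsWithin 0 (Ioi 0)) (nhds 0) := by
  have := sm_lim_top.comp tendsto_inv_nhdsGT_zero
  refine this.congr fun x => ?_
  simp [mul_comm]

lemma sm_lim_pt (b : ℂ) {D : ℝ} (hD : 0 < D) :
    Filter.Tendsto (fun y : ℂ => ‖y - b‖ / D * (|Real.log (‖y - b‖ / D)| + 1) ^ 3)
    (nhdsWithin b {b}ᶜ) (nhds 0) := by
  have : Filter.Tendsto (fun y : ℂ => ‖y - b‖ / D) (nhdsWithin b {b}ᶜ) (nhdsWithin 0 (Ioi 0)) := by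
    refine tendsto_nhdsWithin_iff.2 ⟨?_, ?_⟩
    · have : ContinuousAt (fun y : ℂ => ‖y - b‖ / D) b := by fun_prop
      have h2 := this.tendsto
      simp only [sub_self, norm_zero, zero_div] at h2
      exact h2.mono_left nhdsWithin_le_nhds
    · filter_upwards [self_mem_nhdsWithin] with y hy
      have : 0 < ‖y - b‖ := norm_pos_iff.2 (sub_ne_zero.2 hy)
      exact div_pos this hD
  exact sm_lim_zero.comp this

/-- admissible (value, derivative) pairs. -/
def SmAdm (Y : Set ℂ) (T : ℝ) (y d : ℂ) : Prop :=
  y ∈ Y ∧ ∀ a ∉ Y, ∀ b ∉ Y, a ≠ b →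
    ‖d‖ ≤ T * (‖y - a‖ * (|Real.log (‖y - a‖ / ‖b - a‖)| + 1))

noncomputable def smQ (p q y d : ℂ) : ℂ := d ^ 3 / ((y - p) ^ 2 * (y - q) ^ 2)

lemma smQ_symm (p q y d : ℂ) : smQ p q y d = smQ q p y d := by
  unfold smQ; rw [mul_comm]

lemma sm_bd {Y : Set ℂ} {T : ℝ} {p q y d : ℂ} (hT : 0 ≤ T) (hpq : p ≠ q)
    (hp : p ∉ Y) (hq : q ∉ Y) (h : SmAdm Y T y d) :
    ‖smQ p q y d‖ ≤ T ^ 3 * ‖q - p‖ *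
      (‖y - p‖ / ‖q - p‖ * (|Real.log (‖y - p‖ / ‖q - p‖)| + 1) ^ 3) / ‖y - q‖ ^ 2 := by
  have hD : 0 < ‖q - p‖ := norm_pos_iff.2 (sub_ne_zero.2 hpq.symm)
  have hyp : 0 < ‖y - p‖ := norm_pos_iff.2 (sub_ne_zero.2 (fun e => hp (e ▸ h.1)))
  have hyq : 0 < ‖y - q‖ := norm_pos_iff.2 (sub_ne_zero.2 (fun e => hq (e ▸ h.1)))
  have h1 := h.2 p hp q hq hpq
  set l := |Real.log (‖y - p‖ / ‖q - p‖)|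
  have hl : 0 ≤ l := abs_nonneg _
  simp only [smQ, norm_div, norm_mul, norm_pow]
  calc ‖d‖ ^ 3 / (‖y - p‖ ^ 2 * ‖y - q‖ ^ 2)
      ≤ (T * (‖y - p‖ * (l + 1))) ^ 3 / (‖y - p‖ ^ 2 * ‖y - q‖ ^ 2) := by gcongr
    _ = _ := by field_simp

lemma sm_loc_p {Y : Set ℂ} {T : ℝ} {p q : ℂ} (hT : 0 ≤ T) (hpq : p ≠ q)
    (hp : p ∉ Y) (hq : q ∉ Y) {δ : ℝ} (hδ : 0 < δ) :
    ∃ U : Set ℂ, IsOpen U ∧ p ∈ U ∧ ∀ y ∈ U, ∀ d, SmAdm Y T y d → ‖smQ p q y d‖ < δ := by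
  have hD : 0 < ‖q - p‖ := norm_pos_iff.2 (sub_ne_zero.2 hpq.symm)
  have h2 : Filter.Tendsto (fun y : ℂ => ‖y - q‖ ^ 2) (nhdsWithin p {p}ᶜ) (nhds (‖p - q‖ ^ 2)) := by
    have : ContinuousAt (fun y : ℂ => ‖y - q‖ ^ 2) p := by fun_prop
    exact this.tendsto.mono_left nhdsWithin_le_nhds
  have h3 := ((sm_lim_pt p hD).const_mul (T ^ 3 * ‖q - p‖)).div h2
    (by have := sub_ne_zero.2 hpq; positivity)
  rw [mul_zero, zero_div] at h3
  obtain ⟨U, hU, hpU, hUs⟩ := mem_nhdsWithin.1 (h3.eventually_lt_const hδ)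
  refine ⟨U, hU, hpU, fun y hy d hd => (sm_bd hT hpq hp hq hd).trans_lt ?_⟩
  exact hUs ⟨hy, fun e => hp (e ▸ hd.1)⟩

lemma sm_loc_b {Y : Set ℂ} {T : ℝ} {p q b : ℂ} (hT : 0 ≤ T) (hbp : b ≠ p) (hbq : b ≠ q)
    (hb : b ∉ Y) (hp : p ∉ Y) {δ : ℝ} (hδ : 0 < δ) :
    ∃ U : Set ℂ, IsOpen U ∧ b ∈ U ∧ ∀ y ∈ U, ∀ d, SmAdm Y T y d → ‖smQ p q y d‖ < δ := by
  have hD : 0 < ‖p - b‖ := norm_pos_iff.2 (sub_ne_zero.2 hbp.symm)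
  have h2 : Filter.Tendsto (fun y : ℂ => ‖y - p‖ ^ 2 * ‖y - q‖ ^ 2) (nhdsWithin b {b}ᶜ)
      (nhds (‖b - p‖ ^ 2 * ‖b - q‖ ^ 2)) := by
    have : ContinuousAt (fun y : ℂ => ‖y - p‖ ^ 2 * ‖y - q‖ ^ 2) b := by fun_prop
    exact this.tendsto.mono_left nhdsWithin_le_nhds
  have h3 := (((sm_lim_pt b hD).const_mul (T * ‖p - b‖)).pow 3).div h2
    (by have := sub_ne_zero.2 hbp; have := sub_ne_zero.2 hbq; positivity)
  rw [mul_zero, zero_pow (by norm_num), zero_div] at h3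
  obtain ⟨U, hU, hpU, hUs⟩ := mem_nhdsWithin.1 (h3.eventually_lt_const hδ)
  refine ⟨U, hU, hpU, fun y hy d hd => ?_⟩
  refine lt_of_le_of_lt ?_ (hUs ⟨hy, fun e => hb (e ▸ hd.1)⟩)
  have h1 := hd.2 b hb p hp hbp
  simp only [smQ, norm_div, norm_mul, norm_pow, Pi.div_apply]
  set l := |Real.log (‖y - b‖ / ‖p - b‖)|
  have hl : 0 ≤ l := abs_nonneg _
  have h5 : l + 1 ≤ (l + 1) ^ 3 := le_self_pow₀ (by linarith) (by norm_num)
  have h4 : ‖d‖ ≤ T * ‖p - b‖ * (‖y - b‖ / ‖p - b‖ * (l + 1) ^ 3) := by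
    refine h1.trans ?_
    calc T * (‖y - b‖ * (l + 1)) ≤ T * (‖y - b‖ * (l + 1) ^ 3) := by gcongr
      _ = _ := by field_simp
  gcongr

lemma sm_loc_inf {Y : Set ℂ} {T : ℝ} {p q : ℂ} (hT : 0 ≤ T) (hpq : p ≠ q)
    (hp : p ∉ Y) (hq : q ∉ Y) {δ : ℝ} (hδ : 0 < δ) :
    ∃ M : ℝ, ∀ y, M < ‖y‖ → ∀ d, SmAdm Y T y d → ‖smQ p q y d‖ < δ := by
  have hD : 0 < ‖q - p‖ := norm_pos_iff.2 (sub_ne_zero.2 hpq.symm)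
  have h3 := sm_lim_top.const_mul (4 * T ^ 3 / ‖q - p‖)
  rw [mul_zero] at h3
  obtain ⟨N, hN⟩ := Filter.eventually_atTop.1
    ((h3.eventually_lt_const hδ).and (Filter.eventually_ge_atTop 2))
  refine ⟨‖p‖ + N * ‖q - p‖, fun y hy d hd => (sm_bd hT hpq hp hq hd).trans_lt ?_⟩
  have hx : N ≤ ‖y - p‖ / ‖q - p‖ := by
    rw [le_div_iff₀ hD]
    have := norm_sub_norm_le y p
    linarith
  obtain ⟨h4, h5⟩ := hN _ hx
  have hyq : 0 < ‖y - q‖ := norm_pos_iff.2 (sub_ne_zero.2 (fun e => hq (e ▸ hd.1)))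
  set x := ‖y - p‖ / ‖q - p‖ with hxd
  have hxe : ‖y - p‖ = x * ‖q - p‖ := by rw [hxd]; field_simp
  have h6 : x * ‖q - p‖ / 2 ≤ ‖y - q‖ := by
    have := norm_add_le (y - q) (q - p)
    rw [sub_add_sub_cancel, hxe] at this
    nlinarith
  refine lt_of_le_of_lt ?_ h4
  have hl : 0 ≤ |Real.log x| := abs_nonneg _
  have hx0 : 0 < x := by linarith
  calc T ^ 3 * ‖q - p‖ * (x * (|Real.log x| + 1) ^ 3) / ‖y - q‖ ^ 2
      ≤ T ^ 3 * ‖q - p‖ * (x * (|Real.log x| + 1) ^ 3) / (x * ‖q - p‖ / 2) ^ 2 := by gcongr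
    _ = _ := by field_simp; norm_num

lemma sm_est {Y : Set ℂ} {T : ℝ} {p q : ℂ} (hT : 0 ≤ T) (hpq : p ≠ q)
    (hp : p ∉ Y) (hq : q ∉ Y) {δ : ℝ} (hδ : 0 < δ) :
    ∃ K ⊆ Y, IsCompact K ∧ ∀ y d, SmAdm Y T y d → δ ≤ ‖smQ p q y d‖ → y ∈ K := by
  have hloc : ∀ b : ℂ, b ∉ Y →
      ∃ U : Set ℂ, IsOpen U ∧ b ∈ U ∧ ∀ y ∈ U, ∀ d, SmAdm Y T y d → ‖smQ p q y d‖ < δ := by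
    intro b hb
    by_cases hbp : b = p
    · subst hbp; exact sm_loc_p hT hpq hp hq hδ
    by_cases hbq : b = q
    · subst hbq
      obtain ⟨U, h1, h2, h3⟩ := sm_loc_p hT hpq.symm hq hp hδ
      exact ⟨U, h1, h2, fun y hy d hd => by rw [smQ_symm]; exact h3 y hy d hd⟩
    exact sm_loc_b hT hbp hbq hb hp hδ
  choose! U hUo hUb hU using hloc
  obtain ⟨M, hM⟩ := sm_loc_inf hT hpq hp hq hδ
  refine ⟨Metric.closedBall 0 M \ ⋃ b ∈ Yᶜ, U b, ?_, ?_, ?_⟩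
  · intro y hy
    by_contra h
    exact hy.2 (mem_biUnion h (hUb y h))
  · exact (isCompact_closedBall 0 M).diff (isOpen_biUnion fun b hb => hUo b hb)
  · intro y d hd hle
    refine ⟨?_, ?_⟩
    · rw [mem_closedBall_zero_iff]
      by_contra h
      exact absurd (hM y (not_le.1 h) d hd) (not_lt.2 hle)
    · intro h
      simp only [mem_iUnion] at h
      obtain ⟨b, hb, hy⟩ := h
      exact absurd (hU b hb y hy d hd) (not_lt.2 hle)

lemma sm_bdd {Y : Set ℂ} {T : ℝ} {p q : ℂ} (hT : 0 ≤ T) (hpq : p ≠ q)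
    (hp : p ∉ Y) (hq : q ∉ Y) :
    ∃ B : ℝ, 1 ≤ B ∧ ∀ y d, SmAdm Y T y d → ‖smQ p q y d‖ ≤ B := by
  obtain ⟨K, hKY, hK, hKd⟩ := sm_est hT hpq hp hq (zero_lt_one)
  have hD : 0 < ‖q - p‖ := norm_pos_iff.2 (sub_ne_zero.2 hpq.symm)
  have hc : ContinuousOn (fun y : ℂ => T ^ 3 * ‖q - p‖ *
      (‖y - p‖ / ‖q - p‖ * (|Real.log (‖y - p‖ / ‖q - p‖)| + 1) ^ 3) / ‖y - q‖ ^ 2) K := by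
    have h1 : ∀ y ∈ K, ‖y - p‖ / ‖q - p‖ ≠ 0 := fun y hy => by
      have : 0 < ‖y - p‖ := norm_pos_iff.2 (sub_ne_zero.2 (fun e => hp (e ▸ hKY hy)))
      positivity
    have h2 : ∀ y ∈ K, ‖y - q‖ ^ 2 ≠ 0 := fun y hy => by
      have : 0 < ‖y - q‖ := norm_pos_iff.2 (sub_ne_zero.2 (fun e => hq (e ▸ hKY hy)))
      positivity
    have h3 : ContinuousOn (fun y : ℂ => ‖y - p‖ / ‖q - p‖) K := by fun_prop
    have h4 := (h3.log h1).abs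
    have h5 := continuousOn_const (c := T ^ 3 * ‖q - p‖) (s := K) |>.mul
      (h3.mul ((h4.add (continuousOn_const (c := (1:ℝ)))).pow 3))
    exact h5.div (by fun_prop) h2
  obtain ⟨C, hC⟩ := hK.exists_bound_of_continuousOn hc
  refine ⟨max 1 C, le_max_left _ _, fun y d hd => ?_⟩
  by_cases h : 1 ≤ ‖smQ p q y d‖
  · have := hC y (hKd y d hd h)
    refine le_max_of_le_right (((sm_bd hT hpq hp hq hd).trans (le_abs_self _)).trans ?_)
    simpa only [Real.norm_eq_abs] using this
  · exact le_max_of_le_left (not_le.1 h).le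

lemma sm_adm {Y : Set ℂ} {f : ℂ → ℂ} {c : ℂ} {R : ℝ} (hR : 0 < R)
    (hf : DifferentiableOn ℂ f (Metric.ball c R)) (hm : MapsTo f (Metric.ball c R) Y) :
    SmAdm Y (8000 / R) (f c) (deriv f c) :=
  ⟨hm (Metric.mem_ball_self hR), fun a ha b hb hab => sm_landau2 hR hab hf
    (fun z hz e => ha (e ▸ hm hz)) (fun z hz e => hb (e ▸ hm hz))⟩

lemma sm_max {X : Set ℂ} {g : ℂ → ℂ} (hXo : IsOpen X) (hXc : IsPreconnected X)
    (hg : DifferentiableOn ℂ g X)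
    (hcpt : ∀ ε > 0, IsCompact {t ∈ X | ε ≤ ‖g t‖}) : ∀ t ∈ X, g t = 0 := by
  intro t ht
  by_contra hne
  have hpos : 0 < ‖g t‖ := norm_pos_iff.2 hne
  have hK := hcpt _ hpos
  obtain ⟨a, ha, hmax⟩ := hK.exists_isMaxOn ⟨t, ht, le_rfl⟩
    ((hg.continuousOn.norm).mono (fun x hx => hx.1))
  have hmax' : IsMaxOn (norm ∘ g) X a := by
    intro x hx
    by_cases h : ‖g t‖ ≤ ‖g x‖
    · exact hmax ⟨hx, h⟩
    · exact (not_le.1 h).le.trans ha.2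
  have hcon := Complex.eqOn_of_isPreconnected_of_isMaxOn_norm hXc hXo hg ha.1 hmax'
  have hX : {x ∈ X | ‖g t‖ ≤ ‖g x‖} = X := by
    ext x
    refine ⟨fun h => h.1, fun hx => ⟨hx, ?_⟩⟩
    have e : g x = g t := (hcon hx).trans (hcon ht).symm
    rw [e]
  rw [hX] at hK
  have hcl : IsClopen X := ⟨hK.isClosed, hXo⟩
  rcases isClopen_iff.1 hcl with h | h
  · rw [h] at ht; exact ht
  · rw [h] at hK; exact noncompact_univ ℂ hK
lemma sm_fderiv_an {n : ℕ} {f : (Fin n → ℂ) → ℂ} {w : Fin n → ℂ} (hf : AnalyticAt ℂ f w)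
    (v : Fin n → ℂ) : AnalyticAt ℂ (fun z => fderiv ℂ f z v) w :=
  ((ContinuousLinearMap.apply ℂ ℂ v).analyticAt _).comp hf.fderiv

lemma sm_update_mem {n : ℕ} {X : Fin n → Set ℂ} {z : Fin n → ℂ} (hz : z ∈ univ.pi X) (j : Fin n)
    {t : ℂ} (ht : t ∈ X j) : Function.update z j t ∈ univ.pi X := by
  intro i _
  by_cases h : i = j
  · subst h; simpa using ht
  · rw [Function.update_of_ne h]; exact hz i (mem_univ _)

lemma sm_step {n : ℕ} {X Y : Fin n → Set ℂ} (hXo : ∀ j, IsOpen (X j))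
    (hXc : ∀ j, IsPreconnected (X j)) {p q : Fin n → ℂ} (hpq : ∀ i, p i ≠ q i)
    (hp : ∀ i, p i ∉ Y i) (hq : ∀ i, q i ∉ Y i)
    {F : (Fin n → ℂ) → (Fin n → ℂ)}
    (hF : ∀ i, AnalyticOnNhd ℂ (fun z => F z i) (univ.pi X))
    (hmaps : MapsTo F (univ.pi X) (univ.pi Y))
    (hproper : ∀ K, K ⊆ univ.pi Y → IsCompact K → IsCompact (univ.pi X ∩ F ⁻¹' K))
    (j : Fin n) (k : Fin n → Fin n) (S : Finset (Fin n)) (hk : ∀ i ∈ S, k i ≠ j)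
    (hS : ∀ i ∉ S, ∀ z ∈ univ.pi X, ∀ w ∈ univ.pi X, F z i = F w i) :
    ∀ z ∈ univ.pi X, ∏ i ∈ S, fderiv ℂ (fun z => F z i) z (Pi.single (k i) 1) = 0 := by
  intro z hz
  set D : Fin n → (Fin n → ℂ) → ℂ := fun i w => fderiv ℂ (fun z => F z i) w (Pi.single (k i) 1) with hD
  have hDan : ∀ i, AnalyticOnNhd ℂ (D i) (univ.pi X) := fun i w hw =>
    sm_fderiv_an (hF i w hw) _
  set u : ℂ → (Fin n → ℂ) := Function.update z j with hu
  have humem : ∀ t ∈ X j, u t ∈ univ.pi X := fun t ht => sm_update_mem hz j ht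
  have hud : Differentiable ℂ u := fun t => (hasDerivAt_update z j t).differentiableAt
  have hR : ∀ i, ∃ R > 0, Metric.ball (z (k i)) R ⊆ X (k i) := fun i =>
    Metric.isOpen_iff.1 (hXo (k i)) _ (hz (k i) (mem_univ _))
  choose R hR0 hRs using hR
  have hadm : ∀ i ∈ S, ∀ t ∈ X j, SmAdm (Y i) (8000 / R i) (F (u t) i) (D i (u t)) := by
    intro i hi t ht
    have hut := humem t ht
    have huk : u t (k i) = z (k i) := by rw [hu, Function.update_of_ne (hk i hi)]
    have hmem : ∀ s ∈ Metric.ball (z (k i)) (R i), Function.update (u t) (k i) s ∈ univ.pi X :=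
      fun s hs => sm_update_mem hut _ (hRs i hs)
    have hder : ∀ s ∈ Metric.ball (z (k i)) (R i),
        HasDerivAt (fun s => F (Function.update (u t) (k i) s) i)
          (D i (Function.update (u t) (k i) s)) s := by
      intro s hs
      exact ((hF i _ (hmem s hs)).differentiableAt.hasFDerivAt).comp_hasDerivAt s
        (hasDerivAt_update (u t) (k i) s)
    have := sm_adm (Y := Y i) (hR0 i)
      (fun s hs => (hder s hs).differentiableAt.differentiableWithinAt)
      (fun s hs => hmaps (hmem s hs) i (mem_univ _))
    rw [(hder _ (Metric.mem_ball_self (hR0 i))).deriv, ← huk, Function.update_eq_self] at this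
    exact this
  have hYp : ∀ i ∈ S, ∀ t ∈ X j, F (u t) i - p i ≠ 0 := fun i hi t ht =>
    sub_ne_zero.2 fun e => hp i (e ▸ (hadm i hi t ht).1)
  have hYq : ∀ i ∈ S, ∀ t ∈ X j, F (u t) i - q i ≠ 0 := fun i hi t ht =>
    sub_ne_zero.2 fun e => hq i (e ▸ (hadm i hi t ht).1)
  set G : ℂ → ℂ := fun t => ∏ i ∈ S, smQ (p i) (q i) (F (u t) i) (D i (u t)) with hG
  have hGd : DifferentiableOn ℂ G (X j) := by
    refine DifferentiableOn.fun_finsetProd fun i hi => ?_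
    have h1 : DifferentiableOn ℂ (fun t => D i (u t)) (X j) := fun t ht =>
      ((hDan i _ (humem t ht)).differentiableAt.comp t (hud t)).differentiableWithinAt
    have h2 : DifferentiableOn ℂ (fun t => F (u t) i) (X j) := fun t ht =>
      ((hF i _ (humem t ht)).differentiableAt.comp t (hud t)).differentiableWithinAt
    refine (h1.pow 3).div (((h2.sub_const (p i)).pow 2).mul ((h2.sub_const (q i)).pow 2)) ?_
    intro t ht
    exact mul_ne_zero (pow_ne_zero _ (hYp i hi t ht)) (pow_ne_zero _ (hYq i hi t ht))
  have hB : ∀ i, ∃ B : ℝ, 1 ≤ B ∧ ∀ y d, SmAdm (Y i) (8000 / R i) y d → ‖smQ (p i) (q i) y d‖ ≤ B :=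
    fun i => sm_bdd (by have := hR0 i; positivity) (hpq i) (hp i) (hq i)
  choose B hB1 hB using hB
  have hzero := sm_max (hXo j) (hXc j) hGd (fun ε hε => by
    set P := ∏ i ∈ S, B i with hP
    have hP1 : 1 ≤ P := by
      rw [hP, ← Finset.prod_const_one (s := S) (M := ℝ)]
      exact Finset.prod_le_prod (fun _ _ => zero_le_one) (fun i _ => hB1 i)
    have hKex : ∀ i, ∃ K ⊆ Y i, IsCompact K ∧
        ∀ t ∈ X j, ε ≤ ‖G t‖ → F (u t) i ∈ K := by
      intro i
      by_cases hi : i ∈ S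
      · obtain ⟨K, hK1, hK2, hK3⟩ := sm_est (Y := Y i) (T := 8000 / R i) (δ := ε / P)
          (by have := hR0 i; positivity) (hpq i) (hp i) (hq i) (by positivity)
        refine ⟨K, hK1, hK2, fun t ht hle => hK3 _ _ (hadm i hi t ht) ?_⟩
        rw [div_le_iff₀ (by positivity)]
        refine hle.trans ?_
        rw [hG]
        simp only
        rw [norm_prod, ← Finset.mul_prod_erase S _ hi]
        gcongr
        calc ∏ x ∈ S.erase i, ‖smQ (p x) (q x) (F (u t) x) (D x (u t))‖
            ≤ ∏ x ∈ S.erase i, B x :=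
              Finset.prod_le_prod (fun _ _ => norm_nonneg _) (fun x hx => hB x _ _ (hadm x (Finset.mem_of_mem_erase hx) t ht))
          _ ≤ B i * ∏ x ∈ S.erase i, B x := by
              refine le_mul_of_one_le_left ?_ (hB1 i)
              exact Finset.prod_nonneg fun x _ => by linarith [hB1 x]
          _ = P := Finset.mul_prod_erase S _ hi
      · refine ⟨{F z i}, ?_, isCompact_singleton, fun t ht _ => hS i hi _ (humem t ht) _ hz⟩
        rw [singleton_subset_iff]
        exact hmaps hz i (mem_univ _)
    choose K hK1 hK2 hK3 using hKex
    have hL := hproper (univ.pi K) (fun w hw i hi => hK1 i (hw i hi)) (isCompact_univ_pi hK2)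
    have hL' := hL.image (continuous_apply j)
    have hL'X : (fun w : Fin n → ℂ => w j) '' (univ.pi X ∩ F ⁻¹' univ.pi K) ⊆ X j := by
      rintro _ ⟨w, hw, rfl⟩
      exact hw.1 j (mem_univ _)
    have hcl := ((hGd.continuousOn.norm).mono hL'X).preimage_isClosed_of_isClosed
      hL'.isClosed (isClosed_Ici (a := ε))
    have heq : {t ∈ X j | ε ≤ ‖G t‖} =
        (fun w : Fin n → ℂ => w j) '' (univ.pi X ∩ F ⁻¹' univ.pi K) ∩ (fun t => ‖G t‖) ⁻¹' Ici ε := by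
      ext t
      constructor
      · rintro ⟨ht, hle⟩
        refine ⟨⟨u t, ⟨humem t ht, fun i _ => hK3 i t ht hle⟩, ?_⟩, hle⟩
        simp [hu]
      · rintro ⟨ht, hle⟩
        exact ⟨hL'X ht, hle⟩
    rw [heq]
    exact hL'.of_isClosed_subset hcl inter_subset_left)
  have hzj : z j ∈ X j := hz j (mem_univ _)
  have huz : u (z j) = z := Function.update_eq_self _ _
  have h0 := hzero _ hzj
  rw [hG] at h0
  simp only at h0
  rw [Finset.prod_eq_zero_iff] at h0
  obtain ⟨i, hi, h0⟩ := h0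
  refine Finset.prod_eq_zero hi ?_
  unfold smQ at h0
  rw [div_eq_zero_iff] at h0
  rcases h0 with h0 | h0
  · have := pow_eq_zero_iff (by norm_num) |>.1 h0
    rwa [huz] at this
  · exact absurd h0 (mul_ne_zero (pow_ne_zero _ (hYp i hi _ hzj)) (pow_ne_zero _ (hYq i hi _ hzj)))

lemma sm_prod_zero {n : ℕ} {U : Set (Fin n → ℂ)} (hU : IsOpen U) (hUc : IsPreconnected U)
    (hne : U.Nonempty) {ι : Type*} (S : Finset ι)
    (D : ι → (Fin n → ℂ) → ℂ) (hD : ∀ i, AnalyticOnNhd ℂ (D i) U)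
    (h : ∀ z ∈ U, ∏ i ∈ S, D i z = 0) : ∃ i ∈ S, ∀ z ∈ U, D i z = 0 := by
  classical
  induction S using Finset.induction_on with
  | empty =>
    obtain ⟨z, hz⟩ := hne
    simpa using h z hz
  | insert a S ha ih =>
    by_cases hz : ∀ z ∈ U, D a z = 0
    · exact ⟨a, Finset.mem_insert_self _ _, hz⟩
    push Not at hz
    obtain ⟨z, hzU, hz⟩ := hz
    have hev : ∀ᶠ w in nhds z, ∏ i ∈ S, D i w = 0 := by
      filter_upwards [(hD a z hzU).continuousAt.eventually_ne hz, hU.mem_nhds hzU] with w h1 h2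
      have := h w h2
      rw [Finset.prod_insert ha] at this
      exact (mul_eq_zero.1 this).resolve_left h1
    have han : AnalyticOnNhd ℂ (fun w => ∏ i ∈ S, D i w) U := fun w hw =>
      Finset.analyticAt_fun_prod S (fun i _ => hD i w hw)
    have := han.eqOn_zero_of_preconnected_of_eventuallyEq_zero hUc hzU hev
    obtain ⟨i, hi, h2⟩ := ih (fun w hw => this hw)
    exact ⟨i, Finset.mem_insert_of_mem hi, h2⟩

lemma sm_indep {n : ℕ} {X : Fin n → Set ℂ} (hXo : ∀ j, IsOpen (X j))
    (hXc : ∀ j, IsPreconnected (X j)) {f : (Fin n → ℂ) → ℂ}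
    (hf : AnalyticOnNhd ℂ f (univ.pi X)) (S : Finset (Fin n))
    (hS : ∀ k ∈ S, ∀ z ∈ univ.pi X, fderiv ℂ f z (Pi.single k 1) = 0) :
    ∀ z ∈ univ.pi X, ∀ w ∈ univ.pi X, (∀ k ∉ S, z k = w k) → f z = f w := by
  induction S using Finset.induction_on with
  | empty =>
    intro z _ w _ h
    congr 1; ext k; exact h k (by simp)
  | insert a S ha ih =>
    intro z hz w hw h
    have hwa : w a ∈ X a := hw a (mem_univ _)
    have hza : z a ∈ X a := hz a (mem_univ _)
    have h1 : f (Function.update z a (w a)) = f w := by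
      refine ih (fun k hk => hS k (Finset.mem_insert_of_mem hk)) _ (sm_update_mem hz a hwa) _ hw ?_
      intro k hk
      by_cases hka : k = a
      · subst hka; simp
      · rw [Function.update_of_ne hka]
        exact h k (by simp [hka, hk])
    have hder : ∀ s ∈ X a, HasDerivAt (fun s => f (Function.update z a s)) 0 s := by
      intro s hs
      have := ((hf _ (sm_update_mem hz a hs)).differentiableAt.hasFDerivAt).comp_hasDerivAt s
        (hasDerivAt_update z a s)
      rw [hS a (Finset.mem_insert_self _ _) _ (sm_update_mem hz a hs)] at this
      exact this
    have h2 := (hXo a).is_const_of_deriv_eq_zero (hXc a)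
      (fun s hs => (hder s hs).differentiableAt.differentiableWithinAt)
      (fun s hs => (hder s hs).deriv) hza hwa
    simp only [Function.update_eq_self] at h2
    rw [h2, h1]

theorem sm_core {n : ℕ} {X Y : Fin n → Set ℂ} (hXo : ∀ j, IsOpen (X j))
    (hXc : ∀ j, IsPreconnected (X j)) (hXne : (univ.pi X).Nonempty)
    {p q : Fin n → ℂ} (hpq : ∀ i, p i ≠ q i)
    (hp : ∀ i, p i ∉ Y i) (hq : ∀ i, q i ∉ Y i)
    {F : (Fin n → ℂ) → (Fin n → ℂ)}
    (hF : ∀ i, AnalyticOnNhd ℂ (fun z => F z i) (univ.pi X))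
    (hmaps : MapsTo F (univ.pi X) (univ.pi Y))
    (hproper : ∀ K, K ⊆ univ.pi Y → IsCompact K → IsCompact (univ.pi X ∩ F ⁻¹' K)) :
    ∃ π : Equiv.Perm (Fin n), ∀ i, ∀ z ∈ univ.pi X, ∀ w ∈ univ.pi X,
      z (π i) = w (π i) → F z i = F w i := by
  set N : Finset (Fin n) :=
    {i | ¬ ∀ z ∈ univ.pi X, ∀ w ∈ univ.pi X, F z i = F w i} with hN
  have key : ∀ j, ∃ i, i ∈ N ∧ ∀ z ∈ univ.pi X, ∀ w ∈ univ.pi X, z j = w j → F z i = F w i := by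
    intro j
    have h1 : ∃ i ∈ N, ∀ k, k ≠ j → ∀ z ∈ univ.pi X,
        fderiv ℂ (fun z => F z i) z (Pi.single k 1) = 0 := by
      by_contra hcon
      push Not at hcon
      have hcon' : ∀ i, ∃ k, i ∈ N → k ≠ j ∧ ∃ z ∈ univ.pi X,
          fderiv ℂ (fun z => F z i) z (Pi.single k 1) ≠ 0 := by
        intro i
        by_cases hi : i ∈ N
        · obtain ⟨k, hk⟩ := hcon i hi
          exact ⟨k, fun _ => hk⟩
        · exact ⟨i, fun h => absurd h hi⟩
      choose k hk using hcon'
      have h2 := sm_step hXo hXc hpq hp hq hF hmaps hproper j k N (fun i hi => (hk i hi).1)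
        (fun i hi => by simpa [hN] using hi)
      obtain ⟨i, hi, h3⟩ := sm_prod_zero (isOpen_set_pi finite_univ fun j _ => hXo j)
        (isPreconnected_univ_pi hXc) hXne N _ (fun i w hw => sm_fderiv_an (hF i w hw) _) h2
      obtain ⟨z, hz, h4⟩ := (hk i hi).2
      exact h4 (h3 z hz)
    obtain ⟨i, hi, h2⟩ := h1
    refine ⟨i, hi, fun z hz w hw hzw => ?_⟩
    refine sm_indep hXo hXc (hF i) (Finset.univ.erase j)
      (fun k hk z hz => h2 k (Finset.ne_of_mem_erase hk) z hz) z hz w hw ?_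
    intro k hk
    have : k = j := by simpa using hk
    rw [this]; exact hzw
  choose σ hσN hσ using key
  have hinj : Function.Injective σ := by
    intro j j' hjj
    by_contra hne
    have h1 := hσN j
    rw [hN, Finset.mem_filter] at h1
    apply h1.2
    intro z hz w hw
    have hm := sm_update_mem hz j (hw j (mem_univ _))
    have e1 : F z (σ j) = F (Function.update z j (w j)) (σ j) := by
      rw [hjj]
      refine hσ j' _ hz _ hm ?_
      rw [Function.update_of_ne (Ne.symm hne)]
    rw [e1]
    refine hσ j _ hm _ hw ?_
    simp
  have hbij : Function.Bijective σ := Finite.injective_iff_bijective.1 hinj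
  set e := Equiv.ofBijective σ hbij
  refine ⟨e.symm, fun i z hz w hw h => ?_⟩
  have h1 := hσ (e.symm i) z hz w hw h
  have h2 : σ (e.symm i) = i := e.apply_symm_apply i
  rwa [h2] at h1
noncomputable def smS (a : OnePoint ℂ) (x : ℂ) : OnePoint ℂ :=
  OnePoint.elim a ((x : ℂ) : OnePoint ℂ)
    (fun w => if x = 0 then (∞ : OnePoint ℂ) else ((w + x⁻¹ : ℂ) : OnePoint ℂ))

noncomputable def smD (a z : OnePoint ℂ) : ℂ :=
  OnePoint.elim a (spDown z) (fun w => OnePoint.elim z 0 (fun v => (v - w)⁻¹))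

lemma spDown_coe (x : ℂ) : spDown (x : OnePoint ℂ) = x := rfl
lemma smS_infty (x : ℂ) : smS ∞ x = x := rfl
lemma smS_coe_zero (a : ℂ) : smS a 0 = ∞ := by
  change (if (0:ℂ) = 0 then (∞ : OnePoint ℂ) else _) = _
  simp
lemma smS_coe (a x : ℂ) (hx : x ≠ 0) : smS a x = ((a + x⁻¹ : ℂ) : OnePoint ℂ) := by
  change (if x = 0 then (∞ : OnePoint ℂ) else _) = _
  simp [hx]
lemma smD_infty (z : OnePoint ℂ) : smD ∞ z = spDown z := rfl
lemma smD_coe_infty (a : ℂ) : smD a ∞ = 0 := rfl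
lemma smD_coe_coe (a z : ℂ) : smD a z = (z - a)⁻¹ := rfl
lemma spInv_zero : spInv ((0 : ℂ) : OnePoint ℂ) = ∞ := by
  change (if (0:ℂ) = 0 then (∞ : OnePoint ℂ) else _) = _
  simp
lemma spInv_coe (x : ℂ) (hx : x ≠ 0) : spInv (x : OnePoint ℂ) = ((x⁻¹ : ℂ) : OnePoint ℂ) := by
  change (if x = 0 then (∞ : OnePoint ℂ) else _) = _
  simp [hx]
lemma spInv_infty : spInv ∞ = ((0 : ℂ) : OnePoint ℂ) := rfl

lemma smD_smS (a : OnePoint ℂ) (x : ℂ) : smD a (smS a x) = x := by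
  induction a using OnePoint.rec with
  | infty => rfl
  | coe a =>
    by_cases hx : x = 0
    · subst hx; rw [smS_coe_zero, smD_coe_infty]
    · rw [smS_coe a x hx, smD_coe_coe]; simp

lemma smS_smD (a z : OnePoint ℂ) (h : z ≠ a) : smS a (smD a z) = z := by
  induction a using OnePoint.rec with
  | infty =>
    induction z using OnePoint.rec with
    | infty => exact absurd rfl h
    | coe z => rfl
  | coe a =>
    induction z using OnePoint.rec with
    | infty => rw [smD_coe_infty, smS_coe_zero]
    | coe z =>
      have : z - a ≠ 0 := sub_ne_zero.2 fun e => h (by rw [e])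
      rw [smD_coe_coe, smS_coe _ _ (inv_ne_zero this)]; simp

lemma smS_ne (a : OnePoint ℂ) (x : ℂ) : smS a x ≠ a := by
  induction a using OnePoint.rec with
  | infty => exact OnePoint.coe_ne_infty x
  | coe a =>
    by_cases hx : x = 0
    · subst hx; rw [smS_coe_zero]; exact OnePoint.infty_ne_coe a
    · rw [smS_coe a x hx]
      intro h
      have := OnePoint.coe_injective h
      simp [hx] at this

lemma sm_coe_tendsto : Filter.Tendsto (fun x : ℂ => (x : OnePoint ℂ)) (Bornology.cobounded ℂ)
    (nhds ∞) := by
  have := OnePoint.tendsto_coe_infty (X := ℂ)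
  rwa [Filter.coclosedCompact_eq_cocompact, ← Metric.cobounded_eq_cocompact] at this

lemma smS_cont (a : OnePoint ℂ) : Continuous (smS a) := by
  induction a using OnePoint.rec with
  | infty => exact OnePoint.continuous_coe
  | coe a =>
    rw [continuous_iff_continuousAt]
    intro x
    by_cases hx : x = 0
    · subst hx
      rw [continuousAt_iff_punctured_nhds, smS_coe_zero]
      have h1 : Filter.Tendsto (fun x : ℂ => ((a + x⁻¹ : ℂ) : OnePoint ℂ)) (nhdsWithin 0 {0}ᶜ)
          (nhds ∞) := by
        refine sm_coe_tendsto.comp ?_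
        exact (tendsto_const_add_cobounded a).comp Filter.tendsto_inv₀_nhdsNE_zero
      refine h1.congr' ?_
      filter_upwards [self_mem_nhdsWithin] with x hx
      rw [smS_coe a x hx]
    · have h1 : ContinuousAt (fun x : ℂ => ((a + x⁻¹ : ℂ) : OnePoint ℂ)) x :=
        OnePoint.continuous_coe.continuousAt.comp (continuousAt_const.add (continuousAt_inv₀ hx))
      refine h1.congr ?_
      filter_upwards [isOpen_ne.mem_nhds hx] with y hy
      rw [smS_coe a y hy]

lemma smD_cont (a z : OnePoint ℂ) (h : z ≠ a) : ContinuousAt (smD a) z := by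
  induction a using OnePoint.rec with
  | infty =>
    induction z using OnePoint.rec with
    | infty => exact absurd rfl h
    | coe z =>
      rw [OnePoint.continuousAt_coe]
      exact continuousAt_id
  | coe a =>
    induction z using OnePoint.rec with
    | infty =>
      rw [OnePoint.continuousAt_infty', Filter.coclosedCompact_eq_cocompact,
        ← Metric.cobounded_eq_cocompact, smD_coe_infty]
      exact Filter.tendsto_inv₀_cobounded.comp (by simpa [sub_eq_add_neg] using tendsto_add_const_cobounded (-a))
    | coe z =>
      have : z - a ≠ 0 := sub_ne_zero.2 fun e => h (by rw [e])
      rw [OnePoint.continuousAt_coe]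
      exact ContinuousAt.inv₀ (f := fun z => z - a) (by fun_prop) this

lemma sm_holo_down {E : Type*} [NormedAddCommGroup E] [NormedSpace ℂ E]
    {h : E → OnePoint ℂ} {x : E} (hh : SphHoloAt h x) {a : OnePoint ℂ} (ha : h x ≠ a) :
    AnalyticAt ℂ (fun z => smD a (h z)) x := by
  obtain ⟨hc, hh⟩ := hh
  induction a using OnePoint.rec with
  | infty => exact (hh.resolve_right fun h => ha h.1).2
  | coe a =>
    rcases hh with ⟨h1, h2⟩ | ⟨h1, h2⟩
    · have hne : spDown (h x) - a ≠ 0 := by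
        obtain ⟨w, hw⟩ := OnePoint.ne_infty_iff_exists.1 h1
        rw [← hw] at ha ⊢
        rw [spDown_coe]
        exact sub_ne_zero.2 fun e => ha (by rw [e])
      refine AnalyticAt.congr ((h2.sub analyticAt_const).inv hne) ?_
      filter_upwards [hc.eventually_ne h1] with z hz
      obtain ⟨w, hw⟩ := OnePoint.ne_infty_iff_exists.1 hz
      simp only [Pi.inv_apply, Pi.sub_apply]
      rw [← hw, spDown_coe, smD_coe_coe]
    · have hne : 1 - a * spDown (spInv (h x)) ≠ 0 := by
        rw [h1, spInv_infty, spDown_coe]; simp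
      refine AnalyticAt.congr (h2.div (analyticAt_const.sub (analyticAt_const.mul h2)) hne) ?_
      have h0 : h x ≠ ((0 : ℂ) : OnePoint ℂ) := by rw [h1]; exact OnePoint.infty_ne_coe 0
      have hca := h2.continuousAt
      filter_upwards [hc.eventually_ne h0, hc.eventually_ne ha] with z hz hza
      simp only [Pi.div_apply, Pi.sub_apply, Pi.mul_apply]
      generalize h z = y at hz hza
      induction y using OnePoint.rec with
      | infty => rw [spInv_infty, spDown_coe, smD_coe_infty]; simp
      | coe w =>
        have hw : w ≠ 0 := fun e => hz (by rw [e])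
        have hwa : w - a ≠ 0 := sub_ne_zero.2 fun e => hza (by rw [e])
        rw [spInv_coe w hw, spDown_coe, smD_coe_coe]
        field_simp

lemma sm_chart_eq (p : OnePoint ℂ) : sphChart p (sphChartPt p) = p := by
  unfold sphChart sphChartPt
  induction p using OnePoint.rec with
  | infty => simp [spInv_zero]
  | coe w => simp [spDown_coe]

lemma sm_chart_change (a : OnePoint ℂ) (x : ℂ) : ∃ m : ℂ → ℂ, AnalyticAt ℂ m x ∧
    m x = sphChartPt (smS a x) ∧ ∀ᶠ y in nhds x, smS a y = sphChart (smS a x) (m y) := by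
  induction a using OnePoint.rec with
  | infty =>
    refine ⟨id, analyticAt_id, ?_, ?_⟩
    · simp [smS_infty, sphChartPt, spDown_coe]
    · simp [smS_infty, sphChart]
  | coe a =>
    by_cases hx : x = 0
    · subst hx
      have h1 : AnalyticAt ℂ (fun y : ℂ => 1 + a * y) 0 := by fun_prop
      have hne : (1 + a * (0:ℂ)) ≠ 0 := by simp
      refine ⟨fun y => y / (1 + a * y), analyticAt_id.div h1 hne, ?_, ?_⟩
      · rw [smS_coe_zero]; simp [sphChartPt]
      · filter_upwards [h1.continuousAt.eventually_ne hne] with y hy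
        rw [smS_coe_zero]
        simp only [sphChart, if_true]
        by_cases hy0 : y = 0
        · subst hy0; simp [smS_coe_zero, spInv_zero]
        · rw [smS_coe a y hy0, spInv_coe _ (div_ne_zero hy0 hy)]
          congr 1
          field_simp
          ring
    · refine ⟨fun y => a + y⁻¹, analyticAt_const.add (analyticAt_id.inv hx), ?_, ?_⟩
      · rw [smS_coe a x hx]; simp [sphChartPt, spDown_coe]
      · filter_upwards [isOpen_ne.mem_nhds hx] with y hy
        rw [smS_coe a x hx, smS_coe a y hy]; simp [sphChart]

lemma sm_holo_comp {E E' : Type*} [NormedAddCommGroup E] [NormedSpace ℂ E]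
    [NormedAddCommGroup E'] [NormedSpace ℂ E'] {h : E → OnePoint ℂ} {M : E' → E} {x : E'}
    (hh : SphHoloAt h (M x)) (hM : AnalyticAt ℂ M x) : SphHoloAt (fun z => h (M z)) x := by
  refine ⟨hh.1.comp hM.continuousAt, ?_⟩
  rcases hh.2 with ⟨h1, h2⟩ | ⟨h1, h2⟩
  · exact Or.inl ⟨h1, h2.comp hM⟩
  · exact Or.inr ⟨h1, h2.comp hM⟩

lemma sm_holo_congr {E : Type*} [NormedAddCommGroup E] [NormedSpace ℂ E]
    {h h' : E → OnePoint ℂ} {x : E} (hh : SphHoloAt h x) (he : h =ᶠ[nhds x] h') :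
    SphHoloAt h' x := by
  have hx := he.eq_of_nhds
  refine ⟨hh.1.congr he, ?_⟩
  rcases hh.2 with ⟨h1, h2⟩ | ⟨h1, h2⟩
  · exact Or.inl ⟨hx ▸ h1, h2.congr (he.mono fun z hz => by simp only [hz])⟩
  · exact Or.inr ⟨hx ▸ h1, h2.congr (he.mono fun z hz => by simp only [hz])⟩

lemma sm_holo_pull {n : ℕ} {f : (Fin n → OnePoint ℂ) → OnePoint ℂ}
    {U : Set (Fin n → OnePoint ℂ)} (hf : SphHoloOnProd f U) (a : Fin n → OnePoint ℂ)
    (x : Fin n → ℂ) (hx : (fun j => smS (a j) (x j)) ∈ U) :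
    SphHoloAt (fun z : Fin n → ℂ => f (fun j => smS (a j) (z j))) x := by
  choose m hm1 hm2 hm3 using fun j => sm_chart_change (a j) (x j)
  have hM : AnalyticAt ℂ (fun z : Fin n → ℂ => fun j => m j (z j)) x := by
    rw [analyticAt_pi_iff]
    intro j
    exact (hm1 j).comp_of_eq ((ContinuousLinearMap.proj (R := ℂ) (φ := fun _ : Fin n => ℂ) j).analyticAt x) rfl
  have h1 := hf _ hx
  have hMx : (fun j => m j (x j)) = fun i => sphChartPt (smS (a i) (x i)) := funext hm2
  rw [← hMx] at h1
  refine sm_holo_congr (sm_holo_comp (M := fun z : Fin n → ℂ => fun j => m j (z j)) h1 hM) ?_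
  have hev : ∀ᶠ z in nhds x, ∀ j, smS (a j) (z j) = sphChart (smS (a j) (x j)) (m j (z j)) :=
    Filter.eventually_all.2 fun j => (continuous_apply j).continuousAt.eventually (hm3 j)
  filter_upwards [hev] with z hz
  simp only [hz]

/-- **Main theorem, Riemann-sphere case.** Let `X₁, …, Xₙ` and `Y₁, …, Yₙ` be nonempty open
connected subsets of the Riemann sphere `ℂ∞` whose complements each contain at least three
points (i.e. hyperbolic open connected subsets of `ℂ∞`). Any proper holomorphic map
`F : X₁ × ⋯ × Xₙ → Y₁ × ⋯ × Yₙ` with finite fibers splits: each component `Fᵢ` depends only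
on the variable `z_{π i}` for some permutation `π`. -/
theorem sphere_main_theorem (n : ℕ) (hn : 1 ≤ n) (X Y : Fin n → Set (OnePoint ℂ))
    (hXo : ∀ j, IsOpen (X j)) (hXc : ∀ j, IsConnected (X j))
    (hXhyp : ∀ j, ∃ a b c : OnePoint ℂ, a ≠ b ∧ a ≠ c ∧ b ≠ c ∧ {a, b, c} ⊆ (X j)ᶜ)
    (hYo : ∀ j, IsOpen (Y j)) (hYc : ∀ j, IsConnected (Y j))
    (hYhyp : ∀ j, ∃ a b c : OnePoint ℂ, a ≠ b ∧ a ≠ c ∧ b ≠ c ∧ {a, b, c} ⊆ (Y j)ᶜ)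
    (F : (Fin n → OnePoint ℂ) → (Fin n → OnePoint ℂ))
    (hF : ∀ i, SphHoloOnProd (fun z => F z i) (univ.pi X))
    (hmaps : MapsTo F (univ.pi X) (univ.pi Y))
    (hproper : ∀ K, K ⊆ univ.pi Y → IsCompact K → IsCompact (univ.pi X ∩ F ⁻¹' K))
    (hfin : ∀ w ∈ univ.pi Y, (univ.pi X ∩ F ⁻¹' {w}).Finite) :
    ∃ (π : Equiv.Perm (Fin n)) (g : Fin n → OnePoint ℂ → OnePoint ℂ),
      (∀ i, SphHoloOnS (g i) (X (π i))) ∧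
      (∀ i, MapsTo (g i) (X (π i)) (Y i)) ∧
      (∀ z ∈ univ.pi X, ∀ i, F z i = g i (z (π i))) := by
  choose a _ _ _ _ _ haX using hXhyp
  choose b b' b'' hb1 hb2 hb3 hbY using hYhyp
  have ha : ∀ j, a j ∉ X j := fun j => haX j (by simp)
  have hb : ∀ j, b j ∉ Y j := fun j => hbY j (by simp)
  have hb' : ∀ j, b' j ∉ Y j := fun j => hbY j (by simp)
  have hb'' : ∀ j, b'' j ∉ Y j := fun j => hbY j (by simp)
  set ψ : (Fin n → ℂ) → (Fin n → OnePoint ℂ) := fun x j => smS (a j) (x j) with hψ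
  set X' : Fin n → Set ℂ := fun j => smS (a j) ⁻¹' X j with hX'
  set Y' : Fin n → Set ℂ := fun j => smS (b j) ⁻¹' Y j with hY'
  set F' : (Fin n → ℂ) → (Fin n → ℂ) := fun x i => smD (b i) (F (ψ x) i) with hF'
  have hψm : ∀ x, x ∈ univ.pi X' ↔ ψ x ∈ univ.pi X := fun x => Iff.rfl
  have hXD : ∀ j, X' j = smD (a j) '' X j := by
    intro j
    ext x
    constructor
    · intro hx
      exact ⟨_, hx, smD_smS _ _⟩
    · rintro ⟨z, hz, rfl⟩
      change smS (a j) (smD (a j) z) ∈ X j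
      rwa [smS_smD (a j) z (fun e => ha j (e ▸ hz))]
  have hXco : ∀ j, ContinuousOn (smD (a j)) (X j) := fun j z hz =>
    (smD_cont (a j) z (fun e => ha j (e ▸ hz))).continuousWithinAt
  have hX'c : ∀ j, IsConnected (X' j) := fun j => by
    rw [hXD]; exact (hXc j).image _ (hXco j)
  have hFne : ∀ x ∈ univ.pi X', ∀ i, F (ψ x) i ≠ b i := fun x hx i e =>
    hb i (e ▸ hmaps ((hψm x).1 hx) i (mem_univ _))
  have hSF : ∀ x ∈ univ.pi X', ∀ i, smS (b i) (F' x i) = F (ψ x) i := fun x hx i =>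
    smS_smD _ _ (hFne x hx i)
  obtain ⟨π, hπ⟩ := sm_core (X := X') (Y := Y') (p := fun i => smD (b i) (b' i))
    (q := fun i => smD (b i) (b'' i)) (F := F')
    (fun j => (hXo j).preimage (smS_cont _)) (fun j => (hX'c j).isPreconnected)
    (univ_pi_nonempty_iff.2 fun j => (hX'c j).nonempty)
    (fun i e => hb3 i (by
      have := congrArg (smS (b i)) e
      rwa [smS_smD _ _ (hb1 i).symm, smS_smD _ _ (hb2 i).symm] at this))
    (fun i h => hb' i (by
      have h : smS (b i) (smD (b i) (b' i)) ∈ Y i := h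
      rwa [smS_smD _ _ (hb1 i).symm] at h))
    (fun i h => hb'' i (by
      have h : smS (b i) (smD (b i) (b'' i)) ∈ Y i := h
      rwa [smS_smD _ _ (hb2 i).symm] at h))
    (fun i x hx => sm_holo_down (sm_holo_pull (hF i) a x hx) (hFne x hx i))
    (fun x hx i _ => by
      change smS (b i) (F' x i) ∈ Y i
      rw [hSF x hx i]
      exact hmaps ((hψm x).1 hx) i (mem_univ _))
    (fun K hKY hK => by
      have hcS : Continuous (fun (y : Fin n → ℂ) (i : Fin n) => smS (b i) (y i)) :=
        continuous_pi fun i => (smS_cont _).comp (continuous_apply i)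
      have h1 := hproper _ (by
        rintro _ ⟨y, hy, rfl⟩ i _
        exact hKY hy i (mem_univ _)) (hK.image hcS)
      have h2 := h1.image_of_continuousOn (f := fun (z : Fin n → OnePoint ℂ) (j : Fin n) =>
        smD (a j) (z j)) (by
          refine continuousOn_pi.2 fun j => ?_
          exact (hXco j).comp (continuous_apply j).continuousOn (fun z hz => hz.1 j (mem_univ _)))
      convert h2 using 1
      ext x
      constructor
      · rintro ⟨hx, hxK⟩
        refine ⟨ψ x, ⟨(hψm x).1 hx, F' x, hxK, funext fun i => hSF x hx i⟩, ?_⟩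
        funext j
        exact smD_smS _ _
      · rintro ⟨z, ⟨hz, y, hyK, hy⟩, rfl⟩
        have e1 : ψ (fun j => smD (a j) (z j)) = z := funext fun j =>
          smS_smD _ _ (fun e => ha j (e ▸ hz j (mem_univ _)))
        refine ⟨(hψm _).2 (by rw [e1]; exact hz), ?_⟩
        have e2 : F' (fun j => smD (a j) (z j)) = y := by
          funext i
          simp only [hF', e1, ← hy]
          exact smD_smS _ _
        rw [mem_preimage, e2]; exact hyK)
  have hdep : ∀ i, ∀ z ∈ univ.pi X, ∀ w ∈ univ.pi X, z (π i) = w (π i) → F z i = F w i := by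
    intro i z hz w hw h
    have e1 : ∀ z ∈ univ.pi X, ψ (fun j => smD (a j) (z j)) = z := fun z hz => funext fun j =>
      smS_smD _ _ (fun e => ha j (e ▸ hz j (mem_univ _)))
    have m1 : ∀ z ∈ univ.pi X, (fun j => smD (a j) (z j)) ∈ univ.pi X' := fun z hz =>
      (hψm _).2 (by rw [e1 z hz]; exact hz)
    have h2 := hπ i _ (m1 z hz) _ (m1 w hw) (by simp only [h])
    have h3 := congrArg (smS (b i)) h2
    rwa [hSF _ (m1 z hz), hSF _ (m1 w hw), e1 z hz, e1 w hw] at h3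
  obtain ⟨z0, hz0⟩ : (univ.pi X).Nonempty := univ_pi_nonempty_iff.2 fun j => (hXc j).nonempty
  have hup : ∀ j, ∀ t ∈ X j, Function.update z0 j t ∈ univ.pi X := by
    intro j t ht i _
    by_cases h : i = j
    · subst h; simpa using ht
    · rw [Function.update_of_ne h]; exact hz0 i (mem_univ _)
  refine ⟨π, fun i t => F (Function.update z0 (π i) t) i, ?_, ?_, ?_⟩
  · intro i t ht
    have h1 := hF i _ (hup _ t ht)
    have hpt : (fun k => sphChartPt (Function.update z0 (π i) t k)) =
        Function.update (fun k => sphChartPt (z0 k)) (π i) (sphChartPt t) := by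
      funext k
      by_cases h : k = π i
      · subst h; simp
      · simp [Function.update_of_ne h]
    rw [hpt] at h1
    have hM : AnalyticAt ℂ (Function.update (fun k => sphChartPt (z0 k)) (π i)) (sphChartPt t) := by
      rw [analyticAt_pi_iff]
      intro k
      by_cases h : k = π i
      · subst h; simp only [Function.update_self]; exact analyticAt_id
      · simp only [Function.update_of_ne h]; exact analyticAt_const
    have h2 := sm_holo_comp h1 hM
    refine sm_holo_congr h2 (Filter.Eventually.of_forall fun s => ?_)
    simp only
    congr 1
    congr 1
    funext k
    by_cases h : k = π i
    · subst h; simp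
    · simp [Function.update_of_ne h, sm_chart_eq]
  · intro i t ht
    exact hmaps (hup _ t ht) i (mem_univ _)
  · intro z hz i
    refine hdep i z hz _ (hup _ _ (hz _ (mem_univ _))) ?_
    simp
end
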